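/- For every integer k ≥ 0 and all integers m, n with 4.394·2^k ≤ m ≤ n, one has G(n,k) = G(m,k). (Thus the sequence (G(n,k))_{n≥k} is constant from 4.394·2^k onwards, i.e. n(k) ≤ 4.394·2^k.) -/

import Mathlib

/-- Negate the `i`-th coordinate of a vertex `x` of the hypercube `{-1,1}^n`
(coordinates are `ℤˣ = {-1,1}`). -/
def flipCoord {n : ℕ} (x : Fin n → ℤˣ) (i : Fin n) : Fin n → ℤˣ :=
  Function.update x i (-(x i))

/-- `f` is a `k`-function: every vertex has exactly `k` neighbours where `f` differs. -/
def IsKFun {n : ℕ} {β : Type*} (k : ℕ) (f : (Fin n → ℤˣ) → β) : Prop :=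
  ∀ x, Set.ncard {i : Fin n | f (flipCoord x i) ≠ f x} = k

/-- `F n k`: the number of `k`-functions on `Q_n`. -/
noncomputable def numKFun (n k : ℕ) : ℕ :=
  Nat.card {f : (Fin n → ℤˣ) → ℤˣ // IsKFun k f}

/-- Two real-valued functions on `Q_n` are isomorphic: `f x = ε • g y` with
`y i = α i * x (σ i)` for a sign `ε`, a vector `α ∈ {-1,1}^n` and a permutation `σ`. -/
def Isom {n : ℕ} (f g : (Fin n → ℤˣ) → ℝ) : Prop :=
  ∃ (ε : ℤˣ) (α : Fin n → ℤˣ) (σ : Equiv.Perm (Fin n)),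
    ∀ x, f x = ((ε : ℤ) : ℝ) * g (fun i => α i * x (σ i))

/-- View a Boolean (`ℤˣ`-valued) function as real-valued. -/
noncomputable def toReal {n : ℕ} (f : (Fin n → ℤˣ) → ℤˣ) : (Fin n → ℤˣ) → ℝ :=
  fun x => ((f x : ℤ) : ℝ)

/-- `G n k`: the number of isomorphism classes of `k`-functions on `Q_n`. -/
noncomputable def numIsoKFun (n k : ℕ) : ℕ :=
  Nat.card (Quot fun (f g : {f : (Fin n → ℤˣ) → ℤˣ // IsKFun k f}) =>
    Isom (toReal f.1) (toReal g.1))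

namespace BoolCube

open Finset
open scoped BigOperators symmDiff

section

variable {ι : Type*} [Fintype ι] [DecidableEq ι]

/-- The point of the cube with coordinate `-1` exactly on `S`; multiplying by it flips `S`. -/
def flipSet (S : Finset ι) : ι → ℤˣ := fun i => if i ∈ S then -1 else 1

/-- The Walsh character (monomial) indexed by `S`. -/
def chi (S : Finset ι) (x : ι → ℤˣ) : ℝ := ∏ i ∈ S, ((x i : ℤ) : ℝ)

/-- The Fourier coefficient of `f` at `S`. -/
noncomputable def coef (f : (ι → ℤˣ) → ℝ) (S : Finset ι) : ℝ := 𝔼 x, f x * chi S x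

omit [Fintype ι] in
lemma flipSet_mul_flipSet (S T : Finset ι) : flipSet S * flipSet T = flipSet (S ∆ T) := by
  funext i
  by_cases hS : i ∈ S <;> by_cases hT : i ∈ T <;> simp [flipSet, hS, hT, mem_symmDiff]

omit [Fintype ι] in
lemma flipSet_empty : flipSet (∅ : Finset ι) = 1 := by
  funext i
  simp [flipSet]

omit [Fintype ι] in
lemma mul_flipSet_apply_of_mem {S : Finset ι} {i : ι} (h : i ∈ S) (x : ι → ℤˣ) :
    (x * flipSet S) i = -x i := by
  simp [flipSet, h]

omit [Fintype ι] in
lemma mul_flipSet_apply_of_notMem {S : Finset ι} {i : ι} (h : i ∉ S) (x : ι → ℤˣ) :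
    (x * flipSet S) i = x i := by
  simp [flipSet, h]

lemma unit_sq (u : ℤˣ) : ((u : ℤ) : ℝ) * ((u : ℤ) : ℝ) = 1 := by
  rcases Int.units_eq_one_or u with h | h <;> simp [h]

omit [Fintype ι] [DecidableEq ι] in
lemma chi_empty (x : ι → ℤˣ) : chi ∅ x = 1 := by simp [chi]

omit [Fintype ι] [DecidableEq ι] in
lemma chi_singleton (i : ι) (x : ι → ℤˣ) : chi {i} x = ((x i : ℤ) : ℝ) := by simp [chi]

omit [Fintype ι] [DecidableEq ι] in
lemma chi_mul (S : Finset ι) (x y : ι → ℤˣ) : chi S (x * y) = chi S x * chi S y := by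
  simp [chi, prod_mul_distrib]

lemma chi_eq_prod_univ (S : Finset ι) (x : ι → ℤˣ) :
    chi S x = ∏ i, if i ∈ S then ((x i : ℤ) : ℝ) else 1 := by
  simp [chi, Finset.prod_ite_mem]

lemma chi_mul_chi (S T : Finset ι) (x : ι → ℤˣ) : chi S x * chi T x = chi (S ∆ T) x := by
  simp only [chi_eq_prod_univ, ← prod_mul_distrib]
  refine prod_congr rfl fun i _ => ?_
  by_cases hS : i ∈ S <;> by_cases hT : i ∈ T <;> simp [hS, hT, mem_symmDiff, unit_sq]

omit [Fintype ι] [DecidableEq ι] in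
lemma chi_mul_self (S : Finset ι) (x : ι → ℤˣ) : chi S x * chi S x = 1 := by
  rw [chi, ← prod_mul_distrib]
  exact prod_eq_one fun i _ => unit_sq _

omit [Fintype ι] [DecidableEq ι] in
lemma chi_eq_one_or (S : Finset ι) (x : ι → ℤˣ) : chi S x = 1 ∨ chi S x = -1 :=
  mul_self_eq_one_iff.1 (chi_mul_self S x)

omit [Fintype ι] [DecidableEq ι] in
lemma abs_chi (S : Finset ι) (x : ι → ℤˣ) : |chi S x| = 1 := by
  rcases chi_eq_one_or S x with h | h <;> simp [h]

omit [Fintype ι] in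
lemma chi_flipSet_singleton (S : Finset ι) (i : ι) :
    chi S (flipSet {i}) = if i ∈ S then -1 else 1 := by
  unfold chi flipSet
  split_ifs with h
  · rw [prod_eq_single i] <;> simp +contextual [h]
  · refine prod_eq_one fun j hj => ?_
    have : j ≠ i := fun e => h (e ▸ hj)
    simp [this]

omit [Fintype ι] in
lemma chi_flipSet_of_disjoint {S T : Finset ι} (h : Disjoint S T) : chi S (flipSet T) = 1 := by
  refine prod_eq_one fun j hj => ?_
  simp [flipSet, Finset.disjoint_left.1 h hj]

lemma expect_mul_right (f : (ι → ℤˣ) → ℝ) (y : ι → ℤˣ) : 𝔼 x, f (x * y) = 𝔼 x, f x :=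
  Fintype.expect_equiv (Equiv.mulRight y) _ _ fun _ => rfl

lemma expect_chi (S : Finset ι) : 𝔼 x, chi S x = if S = ∅ then 1 else 0 := by
  split_ifs with h
  · simp [h, chi_empty]
  · obtain ⟨i, hi⟩ := nonempty_iff_ne_empty.2 h
    have := expect_mul_right (chi S) (flipSet {i})
    simp only [chi_mul, chi_flipSet_singleton, hi, if_true, mul_neg, mul_one,
      expect_neg_distrib] at this
    linarith

lemma expect_chi_mul_chi (S T : Finset ι) :
    𝔼 x, chi S x * chi T x = if S = T then 1 else 0 := by
  simp only [chi_mul_chi, expect_chi, ← Finset.bot_eq_empty, symmDiff_eq_bot]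

omit [DecidableEq ι] in
lemma sum_chi (z : ι → ℤˣ) :
    ∑ S : Finset ι, chi S z = if z = 1 then 2 ^ Fintype.card ι else 0 := by
  have h : ∑ S : Finset ι, chi S z = ∏ i, (1 + ((z i : ℤ) : ℝ)) := by
    rw [Finset.prod_one_add, Finset.powerset_univ]
    rfl
  rw [h]
  split_ifs with hz
  · subst hz
    norm_num [Finset.card_univ]
  · obtain ⟨i, hi⟩ : ∃ i, z i ≠ 1 := by
      by_contra! hc
      exact hz (funext hc)
    refine prod_eq_zero (mem_univ i) ?_
    rcases Int.units_eq_one_or (z i) with h | h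
    · exact absurd h hi
    · simp [h]

lemma card_cube : (Fintype.card (ι → ℤˣ) : ℝ) = 2 ^ Fintype.card ι := by
  simp

/-- Fourier inversion. -/
lemma fourier (f : (ι → ℤˣ) → ℝ) (x : ι → ℤˣ) : f x = ∑ S, coef f S * chi S x := by
  have key : ∀ y : ι → ℤˣ, ∑ S, f y * chi S y * chi S x =
      if y = x then f x * 2 ^ Fintype.card ι else 0 := by
    intro y
    have h1 : y * x = 1 ↔ y = x := by
      have : x * x = 1 := funext fun i => by simp
      constructor
      · intro h
        calc y = y * (x * x) := by rw [this, mul_one]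
          _ = x := by rw [← mul_assoc, h, one_mul]
      · rintro rfl
        exact this
    simp only [mul_assoc, ← chi_mul, ← mul_sum, sum_chi, h1]
    split_ifs with h
    · rw [h]
    · simp
  simp only [coef, expect_mul]
  rw [← expect_sum_comm]
  simp only [key]
  rw [Fintype.expect_eq_sum_div_card, sum_ite_eq' univ x, if_pos (mem_univ x), card_cube]
  field_simp

lemma ext_coef {f g : (ι → ℤˣ) → ℝ} (h : ∀ S, coef f S = coef g S) : f = g := by
  funext x
  rw [fourier f, fourier g]
  simp only [h]

lemma coef_zero (S : Finset ι) : coef (0 : (ι → ℤˣ) → ℝ) S = 0 := by simp [coef]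

lemma exists_coef_ne_zero {f : (ι → ℤˣ) → ℝ} (h : f ≠ 0) : ∃ S, coef f S ≠ 0 := by
  by_contra! hc
  exact h (ext_coef fun S => by rw [hc, coef_zero])

lemma parseval_mul (f g : (ι → ℤˣ) → ℝ) : 𝔼 x, f x * g x = ∑ S, coef f S * coef g S := by
  have : ∀ x, f x * g x = ∑ S, coef g S * (f x * chi S x) := by
    intro x
    conv_lhs => rw [fourier g x]
    rw [mul_sum]
    exact sum_congr rfl fun S _ => by ring
  simp only [this]
  rw [expect_sum_comm]
  refine sum_congr rfl fun S _ => ?_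
  rw [← mul_expect, mul_comm]
  rfl

lemma coef_mul_chi (f : (ι → ℤˣ) → ℝ) (S T : Finset ι) :
    coef (fun x => f x * chi T x) S = coef f (S ∆ T) := by
  simp only [coef, mul_assoc, chi_mul_chi, symmDiff_comm]

lemma coef_translate (f : (ι → ℤˣ) → ℝ) (S : Finset ι) (y : ι → ℤˣ) :
    coef (fun x => f (x * y)) S = coef f S * chi S y := by
  have h : ∀ x, f (x * y) * chi S x = f (x * y) * chi S (x * y) * chi S y := by
    intro x
    rw [chi_mul]
    linear_combination (-(f (x * y) * chi S x)) * chi_mul_self S y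
  simp only [coef, h]
  rw [expect_mul_right (fun x => f x * chi S x * chi S y), expect_mul]

lemma coef_add (f g : (ι → ℤˣ) → ℝ) (S : Finset ι) :
    coef (fun x => f x + g x) S = coef f S + coef g S := by
  simp only [coef, add_mul, expect_add_distrib]

lemma coef_sub (f g : (ι → ℤˣ) → ℝ) (S : Finset ι) :
    coef (fun x => f x - g x) S = coef f S - coef g S := by
  simp only [coef, sub_mul, expect_sub_distrib]

lemma coef_const_mul (c : ℝ) (f : (ι → ℤˣ) → ℝ) (S : Finset ι) :
    coef (fun x => c * f x) S = c * coef f S := by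
  simp only [coef, mul_assoc, ← mul_expect]

lemma coef_chi (S T : Finset ι) : coef (chi S) T = if S = T then 1 else 0 :=
  expect_chi_mul_chi S T

lemma coef_mul (f g : (ι → ℤˣ) → ℝ) (S : Finset ι) :
    coef (fun x => f x * g x) S = ∑ T, coef f T * coef g (S ∆ T) := by
  have h : coef (fun x => f x * g x) S = 𝔼 x, f x * (g x * chi S x) := by
    simp only [coef, mul_assoc]
  rw [h, parseval_mul]
  simp only [coef_mul_chi, symmDiff_comm]

/-- `f` has no monomial of degree larger than `d`. -/
def DegLE (f : (ι → ℤˣ) → ℝ) (d : ℕ) : Prop := ∀ S : Finset ι, d < #S → coef f S = 0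

/-- The discrete derivative of `f` in direction `i`. -/
noncomputable def deriv (i : ι) (f : (ι → ℤˣ) → ℝ) : (ι → ℤˣ) → ℝ :=
  fun x => ((x i : ℤ) : ℝ) * (f x - f (x * flipSet {i})) / 2

/-- The restriction of `f` obtained by setting the `i`-th coordinate to `s`. -/
def restr (i : ι) (s : ℤˣ) (f : (ι → ℤˣ) → ℝ) : (ι → ℤˣ) → ℝ :=
  fun x => f (Function.update x i s)

/-- The restriction of `f` obtained by setting the coordinates in `M` to those of `y`. -/
def restrSet (M : Finset ι) (y : ι → ℤˣ) (f : (ι → ℤˣ) → ℝ) : (ι → ℤˣ) → ℝ :=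
  fun x => f (M.piecewise y x)

/-- The degree of `f` as a multilinear polynomial (`0` for the zero function). -/
noncomputable def deg (f : (ι → ℤˣ) → ℝ) : ℕ := by
  classical exact (univ.filter fun S => coef f S ≠ 0).sup card

/-- The weight of `f`: zero for the zero function, `2 ^ (-(deg f + 1))` otherwise. -/
noncomputable def weight (f : (ι → ℤˣ) → ℝ) : ℝ := by
  classical exact if f = 0 then 0 else (1 / 2) ^ (deg f + 1)

/-- The sum of the weights of all derivatives. -/
noncomputable def totalWeight (f : (ι → ℤˣ) → ℝ) : ℝ := ∑ i, weight (deriv i f)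

/-- The influence of coordinate `i`. -/
noncomputable def infl (i : ι) (f : (ι → ℤˣ) → ℝ) : ℝ := 𝔼 x, deriv i f x ^ 2

/-- The total influence. -/
noncomputable def totalInfl (f : (ι → ℤˣ) → ℝ) : ℝ := ∑ i, infl i f

/-- `f` takes values in `{-1, 1}`. -/
def IsBool (f : (ι → ℤˣ) → ℝ) : Prop := ∀ x, f x = 1 ∨ f x = -1

lemma DegLE.mono {f : (ι → ℤˣ) → ℝ} {d e : ℕ} (h : DegLE f d) (hde : d ≤ e) : DegLE f e :=
  fun S hS => h S (hde.trans_lt hS)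

lemma card_le_deg {f : (ι → ℤˣ) → ℝ} {S : Finset ι} (h : coef f S ≠ 0) : #S ≤ deg f := by
  classical
  unfold deg
  have hS : S ∈ univ.filter fun S => coef f S ≠ 0 := by simpa using h
  convert le_sup (f := card) hS

lemma degLE_deg (f : (ι → ℤˣ) → ℝ) : DegLE f (deg f) := by
  intro S hS
  by_contra h
  exact absurd (card_le_deg h) (by omega)

lemma deg_le_of_degLE {f : (ι → ℤˣ) → ℝ} {d : ℕ} (h : DegLE f d) : deg f ≤ d := by
  classical
  unfold deg
  refine Finset.sup_le fun S hS => ?_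
  by_contra hc
  exact (mem_filter.1 hS).2 (h S (by omega))

lemma exists_card_eq_deg {f : (ι → ℤˣ) → ℝ} (h : f ≠ 0) : ∃ S, #S = deg f ∧ coef f S ≠ 0 := by
  classical
  obtain ⟨S, hS⟩ := exists_coef_ne_zero h
  have hne : (univ.filter fun S => coef f S ≠ 0).Nonempty := ⟨S, by simpa using hS⟩
  obtain ⟨T, hT, hT2⟩ := exists_max_image _ card hne
  refine ⟨T, le_antisymm (card_le_deg (by simpa using hT)) ?_, by simpa using hT⟩
  refine deg_le_of_degLE fun U hU => ?_
  by_contra hc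
  exact absurd (hT2 U (by simpa using hc)) (by omega)

lemma weight_zero : weight (0 : (ι → ℤˣ) → ℝ) = 0 := by simp [weight]

lemma weight_of_ne_zero {f : (ι → ℤˣ) → ℝ} (h : f ≠ 0) : weight f = (1 / 2) ^ (deg f + 1) := by
  simp [weight, h]

lemma weight_nonneg (f : (ι → ℤˣ) → ℝ) : 0 ≤ weight f := by
  by_cases h : f = 0
  · rw [h, weight_zero]
  · rw [weight_of_ne_zero h]
    positivity

lemma weight_le_of_coef {f : (ι → ℤˣ) → ℝ} {S : Finset ι} (h : coef f S ≠ 0) :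
    weight f ≤ (1 / 2) ^ (#S + 1) := by
  have hf : f ≠ 0 := by
    rintro rfl
    exact h (coef_zero S)
  rw [weight_of_ne_zero hf]
  exact pow_le_pow_of_le_one (by norm_num) (by norm_num) (by have := card_le_deg h; omega)

lemma le_weight {f : (ι → ℤˣ) → ℝ} {d : ℕ} (hf : f ≠ 0) (h : DegLE f d) :
    (1 / 2) ^ (d + 1) ≤ weight f := by
  rw [weight_of_ne_zero hf]
  exact pow_le_pow_of_le_one (by norm_num) (by norm_num) (by have := deg_le_of_degLE h; omega)

lemma coef_deriv (i : ι) (f : (ι → ℤˣ) → ℝ) (S : Finset ι) :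
    coef (deriv i f) S = if i ∈ S then 0 else coef f (insert i S) := by
  have h : deriv i f = fun x => (1 / 2) * ((f x - f (x * flipSet {i})) * chi {i} x) := by
    funext x
    rw [chi_singleton, deriv]
    ring
  rw [h, coef_const_mul, coef_mul_chi (fun x => f x - f (x * flipSet {i})), coef_sub,
    coef_translate, chi_flipSet_singleton]
  by_cases hi : i ∈ S
  · simp [hi, mem_symmDiff]
  · have : S ∆ {i} = insert i S := by
      ext j
      by_cases hj : j = i <;> simp [mem_symmDiff, hj, hi]
    simp only [this, mem_insert_self, if_true, hi, if_false]
    ring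

omit [Fintype ι] in
lemma restr_add (j : ι) (F : (ι → ℤˣ) → ℝ) (x : ι → ℤˣ) :
    restr j 1 F x + restr j (-1) F x = F x + F (x * flipSet {j}) := by
  have h1 : Function.update x j (x j) = x := Function.update_eq_self _ _
  have h2 : Function.update x j (-x j) = x * flipSet {j} := by
    funext i
    by_cases h : i = j
    · subst h
      simp [flipSet]
    · simp [flipSet, h]
  unfold restr
  rcases Int.units_eq_one_or (x j) with h | h
  · rw [h] at h1 h2
    rw [h1, h2]
  · rw [h] at h1
    rw [h, neg_neg] at h2
    rw [h1, h2, add_comm]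

omit [Fintype ι] in
lemma restr_eq (j : ι) (s : ℤˣ) (f : (ι → ℤˣ) → ℝ) (x : ι → ℤˣ) :
    restr j s f x = 1 / 2 * (f x + f (x * flipSet {j})) + ((s : ℤ) : ℝ) * deriv j f x := by
  have h1 : Function.update x j (x j) = x := Function.update_eq_self _ _
  have h2 : Function.update x j (-x j) = x * flipSet {j} := by
    funext i
    by_cases h : i = j
    · subst h
      simp [flipSet]
    · simp [flipSet, h]
  unfold restr deriv
  have h3 : s = x j ∨ s = - x j := by
    rcases Int.units_eq_one_or (x j) with h | h <;> rcases Int.units_eq_one_or s with h' | h' <;>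
      simp [h, h']
  rcases h3 with rfl | rfl
  · rw [h1]
    linear_combination (-(f x - f (x * flipSet {j})) / 2) * unit_sq (x j)
  · rw [h2]
    push_cast
    linear_combination ((f x - f (x * flipSet {j})) / 2) * unit_sq (x j)

lemma coef_restr (j : ι) (s : ℤˣ) (f : (ι → ℤˣ) → ℝ) (S : Finset ι) :
    coef (restr j s f) S =
      if j ∈ S then 0 else coef f S + ((s : ℤ) : ℝ) * coef f (insert j S) := by
  rw [show restr j s f = fun x => 1 / 2 * (f x + f (x * flipSet {j})) +
    ((s : ℤ) : ℝ) * deriv j f x from funext (restr_eq j s f), coef_add, coef_const_mul,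
    coef_const_mul, coef_add, coef_translate, chi_flipSet_singleton, coef_deriv]
  split_ifs <;> ring

lemma DegLE.restr {f : (ι → ℤˣ) → ℝ} {d : ℕ} (h : DegLE f d) (j : ι) (s : ℤˣ) :
    DegLE (restr j s f) d := by
  intro S hS
  rw [coef_restr]
  split_ifs with hj
  · rfl
  · rw [h S hS, h (insert j S) (by rw [card_insert_of_notMem hj]; omega)]
    ring

lemma DegLE.deriv {f : (ι → ℤˣ) → ℝ} {d : ℕ} (h : DegLE f d) (i : ι) :
    DegLE (deriv i f) (d - 1) := by
  intro S hS
  rw [coef_deriv]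
  split_ifs with hj
  · rfl
  · exact h _ (by rw [card_insert_of_notMem hj]; omega)

lemma expect_restr (j : ι) (F : (ι → ℤˣ) → ℝ) :
    𝔼 x, F x = (𝔼 x, restr j 1 F x + 𝔼 x, restr j (-1) F x) / 2 := by
  rw [← expect_add_distrib]
  simp only [restr_add]
  rw [expect_add_distrib, expect_mul_right]
  ring

omit [Fintype ι] in
lemma eq_restr (j : ι) (f : (ι → ℤˣ) → ℝ) (x : ι → ℤˣ) : f x = restr j (x j) f x := by
  rw [restr, Function.update_eq_self]

lemma weight_le_half_of_restr_eq_zero {g : (ι → ℤˣ) → ℝ} {j : ι} {s : ℤˣ} (hg : g ≠ 0)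
    (h : restr j s g = 0) : weight g ≤ weight (restr j (-s) g) / 2 := by
  have hne : restr j (-s) g ≠ 0 := by
    intro h0
    refine hg (funext fun x => ?_)
    rw [eq_restr j g x]
    have h3 : x j = s ∨ x j = - s := by
      rcases Int.units_eq_one_or (x j) with h | h <;>
      rcases Int.units_eq_one_or s with h' | h' <;> simp [h, h']
    rcases h3 with h3 | h3 <;> rw [h3]
    · rw [h]
    · rw [h0]
  obtain ⟨S, hS, hS2⟩ := exists_card_eq_deg hne
  have hS3 := coef_restr j s g S
  rw [h, coef_zero] at hS3
  rw [coef_restr] at hS2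
  split_ifs at hS2 hS3 with hj
  · exact absurd rfl hS2
  · have hc : coef g (insert j S) ≠ 0 := by
      intro h0
      rw [h0] at hS2 hS3
      simp only [mul_zero, add_zero] at hS2 hS3
      exact hS2 hS3.symm
    have := card_le_deg hc
    rw [card_insert_of_notMem hj, hS] at this
    rw [weight_of_ne_zero hg, weight_of_ne_zero hne]
    calc ((1 : ℝ) / 2) ^ (deg g + 1) ≤ (1 / 2) ^ (deg (restr j (-s) g) + 1 + 1) :=
          pow_le_pow_of_le_one (by norm_num) (by norm_num) (by omega)
      _ = _ := by ring

lemma weight_le_restr (j : ι) (g : (ι → ℤˣ) → ℝ) :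
    weight g ≤ (weight (restr j 1 g) + weight (restr j (-1) g)) / 2 := by
  by_cases hg : g = 0
  · rw [hg, weight_zero]
    have := weight_nonneg (restr j 1 (0 : (ι → ℤˣ) → ℝ))
    have := weight_nonneg (restr j (-1) (0 : (ι → ℤˣ) → ℝ))
    positivity
  by_cases h1 : restr j 1 g = 0
  · have := weight_le_half_of_restr_eq_zero hg h1
    rw [h1, weight_zero]
    linarith
  by_cases h2 : restr j (-1) g = 0
  · have := weight_le_half_of_restr_eq_zero hg h2
    rw [neg_neg] at this
    rw [h2, weight_zero]
    linarith
  have e1 := le_weight h1 ((degLE_deg g).restr j 1)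
  have e2 := le_weight h2 ((degLE_deg g).restr j (-1))
  rw [weight_of_ne_zero hg]
  linarith

omit [Fintype ι] in
lemma deriv_restr_of_ne {i j : ι} (h : i ≠ j) (s : ℤˣ) (f : (ι → ℤˣ) → ℝ) :
    deriv i (restr j s f) = restr j s (deriv i f) := by
  funext x
  have : Function.update (x * flipSet {i}) j s = Function.update x j s * flipSet {i} := by
    funext l
    by_cases hl : l = j
    · subst hl
      simp [flipSet, h.symm]
    · simp [hl]
  simp [deriv, restr, this, h]

omit [Fintype ι] in
lemma deriv_restr_self (j : ι) (s : ℤˣ) (f : (ι → ℤˣ) → ℝ) : deriv j (restr j s f) = 0 := by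
  funext x
  have : Function.update (x * flipSet {j}) j s = Function.update x j s := by
    funext l
    by_cases hl : l = j
    · subst hl
      simp
    · simp [hl, flipSet]
  simp [deriv, restr, this]

lemma totalWeight_le_restr (j : ι) (f : (ι → ℤˣ) → ℝ) :
    totalWeight f ≤ weight (deriv j f) +
      (totalWeight (restr j 1 f) + totalWeight (restr j (-1) f)) / 2 := by
  unfold totalWeight
  rw [← sum_add_distrib, sum_div, ← add_sum_erase _ _ (mem_univ j)]
  rw [← add_sum_erase _ (fun i => (_ + _) / 2) (mem_univ j)]
  simp only [deriv_restr_self, weight_zero]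
  have : ∑ i ∈ univ.erase j, weight (deriv i f) ≤ ∑ i ∈ univ.erase j,
      (weight (deriv i (restr j 1 f)) + weight (deriv i (restr j (-1) f))) / 2 := by
    refine sum_le_sum fun i hi => ?_
    rw [deriv_restr_of_ne (ne_of_mem_erase hi), deriv_restr_of_ne (ne_of_mem_erase hi)]
    exact weight_le_restr _ _
  linarith

lemma totalInfl_restr (j : ι) (f : (ι → ℤˣ) → ℝ) :
    totalInfl f = infl j f + (totalInfl (restr j 1 f) + totalInfl (restr j (-1) f)) / 2 := by
  unfold totalInfl
  rw [← sum_add_distrib, sum_div, ← add_sum_erase _ _ (mem_univ j)]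
  rw [← add_sum_erase _ (fun i => (_ + _) / 2) (mem_univ j)]
  have h0 : ∀ s, infl j (restr j s f) = 0 := by
    intro s
    simp [infl, deriv_restr_self]
  rw [h0, h0]
  have : ∑ i ∈ univ.erase j, infl i f = ∑ i ∈ univ.erase j,
      (infl i (restr j 1 f) + infl i (restr j (-1) f)) / 2 := by
    refine sum_congr rfl fun i hi => ?_
    simp only [infl]
    rw [deriv_restr_of_ne (ne_of_mem_erase hi), deriv_restr_of_ne (ne_of_mem_erase hi)]
    exact expect_restr j fun x => deriv i f x ^ 2
  linarith

omit [Fintype ι] in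
lemma restrSet_empty (y : ι → ℤˣ) (f : (ι → ℤˣ) → ℝ) : restrSet ∅ y f = f := by
  funext x
  simp [restrSet]

omit [Fintype ι] in
lemma restrSet_insert {j : ι} {M : Finset ι} (y : ι → ℤˣ) (f : (ι → ℤˣ) → ℝ) :
    restrSet (insert j M) y f = restrSet M y (restr j (y j) f) := by
  funext x
  simp [restrSet, restr, piecewise_insert]

lemma weight_le_restrSet (M : Finset ι) (g : (ι → ℤˣ) → ℝ) :
    weight g ≤ 𝔼 y, weight (restrSet M y g) := by
  induction M using Finset.induction_on generalizing g with
  | empty => simp [restrSet_empty]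
  | insert j M hj ih =>
    have h1 := weight_le_restr j g
    have h2 := ih (restr j 1 g)
    have h3 := ih (restr j (-1) g)
    have h4 : 𝔼 y, weight (restrSet (insert j M) y g) =
        (𝔼 y, weight (restrSet M y (restr j 1 g)) +
          𝔼 y, weight (restrSet M y (restr j (-1) g))) / 2 := by
      rw [expect_restr j, ← expect_add_distrib, ← expect_add_distrib]
      congr 1
      refine expect_congr rfl fun y _ => ?_
      have h5 : ∀ s, restrSet M (Function.update y j s) = restrSet M y (ι := ι) := by
        intro s
        funext f x
        unfold restrSet
        congr 1
        funext i
        by_cases hi : i ∈ M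
        · have : i ≠ j := fun h => hj (h ▸ hi)
          simp [hi, this]
        · simp [hi]
      simp [restr, restrSet_insert, h5]
    linarith

omit [Fintype ι] in
lemma deriv_restrSet_of_mem {i : ι} {M : Finset ι} (hi : i ∈ M) (y : ι → ℤˣ)
    (f : (ι → ℤˣ) → ℝ) : deriv i (restrSet M y f) = 0 := by
  funext x
  have : M.piecewise y (x * flipSet {i}) = M.piecewise y x := by
    funext l
    by_cases hl : l ∈ M
    · simp [hl]
    · have : l ≠ i := fun h => hl (h ▸ hi)
      simp [hl, flipSet, this]
  simp [deriv, restrSet, this]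

omit [Fintype ι] in
lemma deriv_restrSet_of_notMem {i : ι} {M : Finset ι} (hi : i ∉ M) (y : ι → ℤˣ)
    (f : (ι → ℤˣ) → ℝ) : deriv i (restrSet M y f) = restrSet M y (deriv i f) := by
  funext x
  have : M.piecewise y (x * flipSet {i}) = M.piecewise y x * flipSet {i} := by
    funext l
    by_cases hl : l ∈ M
    · have : l ≠ i := fun h => hi (h ▸ hl)
      simp [hl, flipSet, this]
    · simp [hl]
  simp [deriv, restrSet, this, hi]

lemma totalWeight_le_restrSet (M : Finset ι) (f : (ι → ℤˣ) → ℝ) :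
    totalWeight f ≤ ∑ i ∈ M, weight (deriv i f) + 𝔼 y, totalWeight (restrSet M y f) := by
  unfold totalWeight
  rw [expect_sum_comm, ← sum_add_sum_compl M, ← sum_add_sum_compl M
    (fun i => 𝔼 y, weight (deriv i (restrSet M y f)))]
  have h1 : ∑ i ∈ M, 𝔼 y, weight (deriv i (restrSet M y f)) = 0 := by
    refine sum_eq_zero fun i hi => ?_
    simp [deriv_restrSet_of_mem hi, weight_zero]
  have h2 : ∑ i ∈ Mᶜ, weight (deriv i f) ≤ ∑ i ∈ Mᶜ, 𝔼 y, weight (deriv i (restrSet M y f)) := by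
    refine sum_le_sum fun i hi => ?_
    simp only [deriv_restrSet_of_notMem (mem_compl.1 hi)]
    exact weight_le_restrSet _ _
  linarith

lemma DegLE.restrSet {f : (ι → ℤˣ) → ℝ} {d : ℕ} (h : DegLE f d) (M : Finset ι) (y : ι → ℤˣ) :
    DegLE (restrSet M y f) d := by
  induction M using Finset.induction_on generalizing f with
  | empty => rwa [restrSet_empty]
  | insert j M hj ih =>
    rw [restrSet_insert]
    exact ih (h.restr _ _)

/-- The sum of `g * chi N` over all flips of `x` inside `M`. -/
noncomputable def flipSum (M N : Finset ι) (g : (ι → ℤˣ) → ℝ) : (ι → ℤˣ) → ℝ :=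
  fun x => ∑ S ∈ M.powerset, g (x * flipSet S) * chi N (x * flipSet S)

omit [Fintype ι] in
lemma sum_chi_flipSet (M U : Finset ι) :
    ∑ S ∈ M.powerset, chi U (flipSet S) = if Disjoint U M then 2 ^ #M else 0 := by
  have h : ∀ S, chi U (flipSet S) = ∏ i ∈ S, (if i ∈ U then (-1 : ℝ) else 1) := by
    intro S
    have : chi U (flipSet S) = ∏ i ∈ U, (if i ∈ S then (-1 : ℝ) else 1) := by
      refine prod_congr rfl fun i _ => ?_
      by_cases hi : i ∈ S <;> simp [flipSet, hi]
    rw [this, Finset.prod_ite_mem, Finset.prod_ite_mem, inter_comm]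
  simp only [h]
  rw [← Finset.prod_one_add]
  split_ifs with hd
  · rw [← prod_const]
    refine prod_congr rfl fun i hi => ?_
    rw [if_neg (Finset.disjoint_right.1 hd hi)]
    norm_num
  · obtain ⟨i, hi, hi2⟩ := Finset.not_disjoint_iff.1 hd
    refine prod_eq_zero hi2 ?_
    simp [hi]

lemma coef_flipSum (M N : Finset ι) (g : (ι → ℤˣ) → ℝ) (T : Finset ι) :
    coef (flipSum M N g) T = if Disjoint T M then 2 ^ #M * coef g (T ∆ N) else 0 := by
  have h : coef (flipSum M N g) T =
      ∑ S ∈ M.powerset, coef (fun x => g (x * flipSet S) * chi N (x * flipSet S)) T := by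
    simp only [coef, flipSum, sum_mul]
    rw [expect_sum_comm]
  rw [h]
  have h2 : ∀ S, coef (fun x => g (x * flipSet S) * chi N (x * flipSet S)) T =
      coef g (T ∆ N) * chi T (flipSet S) := by
    intro S
    rw [← coef_mul_chi, ← coef_translate]
  simp only [h2]
  rw [← mul_sum, sum_chi_flipSet]
  split_ifs <;> ring

lemma card_lt_card_symmDiff {T M : Finset ι} (h : Disjoint T M) (hT : T ≠ ∅) :
    #M < #(T ∆ M) := by
  rw [h.symmDiff_eq_sup, sup_eq_union, card_union_of_disjoint h]
  have := card_pos.2 (nonempty_iff_ne_empty.2 hT)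
  omega

lemma flipSum_self {g : (ι → ℤˣ) → ℝ} {M : Finset ι} (h : DegLE g #M) (x : ι → ℤˣ) :
    flipSum M M g x = 2 ^ #M * coef g M := by
  have : flipSum M M g = fun x => (2 ^ #M * coef g M) * chi ∅ x := by
    refine ext_coef fun T => ?_
    rw [coef_flipSum, coef_const_mul, coef_chi]
    by_cases hT : T = ∅
    · subst hT
      simp [← bot_eq_empty]
    · rw [if_neg (Ne.symm hT)]
      split_ifs with hd
      · rw [h _ (card_lt_card_symmDiff hd hT)]
        simp
      · simp
  simp only [this, chi_empty, mul_one]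

lemma expect_sum_flipSet (M : Finset ι) (F : (ι → ℤˣ) → ℝ) :
    𝔼 x, ∑ S ∈ M.powerset, F (x * flipSet S) = 2 ^ #M * 𝔼 x, F x := by
  rw [expect_sum_comm]
  simp only [expect_mul_right]
  simp

/-- The Schwartz–Zippel bound on the cube. -/
lemma schwartz_zippel {H : (ι → ℤˣ) → ℝ} (hH : H ≠ 0) {P : (ι → ℤˣ) → ℝ}
    (hP0 : ∀ x, 0 ≤ P x) (hP : ∀ x, H x ≠ 0 → 1 ≤ P x) : (1 / 2) ^ deg H ≤ 𝔼 x, P x := by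
  obtain ⟨U, hU, hU2⟩ := exists_card_eq_deg hH
  have h1 : ∀ x, 1 ≤ ∑ S ∈ U.powerset, P (x * flipSet S) := by
    intro x
    have h2 := flipSum_self (M := U) (g := H) (hU ▸ degLE_deg H) x
    have h3 : flipSum U U H x ≠ 0 := by
      rw [h2]
      positivity
    obtain ⟨S, hS, hS2⟩ := exists_ne_zero_of_sum_ne_zero h3
    exact (hP _ (left_ne_zero_of_mul hS2)).trans
      (single_le_sum (f := fun S => P (x * flipSet S)) (fun _ _ => hP0 _) hS)
  have h4 : (1 : ℝ) ≤ 𝔼 x, ∑ S ∈ U.powerset, P (x * flipSet S) :=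
    le_expect univ_nonempty fun x _ => h1 x
  rw [expect_sum_flipSet, hU] at h4
  rw [one_div, inv_pow, inv_le_iff_one_le_mul₀ (by positivity), mul_comm]
  exact h4

omit [Fintype ι] in
lemma IsBool.deriv {f : (ι → ℤˣ) → ℝ} (hf : IsBool f) (i : ι) (x : ι → ℤˣ) :
    deriv i f x = 0 ∨ deriv i f x = 1 ∨ deriv i f x = -1 := by
  unfold BoolCube.deriv
  rcases Int.units_eq_one_or (x i) with h | h <;> rcases hf x with h1 | h1 <;>
    rcases hf (x * flipSet {i}) with h2 | h2 <;> rw [h, h1, h2] <;> norm_num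

omit [Fintype ι] in
lemma IsBool.restr {f : (ι → ℤˣ) → ℝ} (hf : IsBool f) (i : ι) (s : ℤˣ) : IsBool (restr i s f) :=
  fun _ => hf _

omit [Fintype ι] in
lemma IsBool.restrSet {f : (ι → ℤˣ) → ℝ} (hf : IsBool f) (M : Finset ι) (y : ι → ℤˣ) :
    IsBool (restrSet M y f) :=
  fun _ => hf _

lemma infl_nonneg (i : ι) (f : (ι → ℤˣ) → ℝ) : 0 ≤ infl i f :=
  expect_nonneg fun _ _ => sq_nonneg _

lemma IsBool.weight_le_infl {f : (ι → ℤˣ) → ℝ} (hf : IsBool f) (i : ι) :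
    weight (BoolCube.deriv i f) ≤ infl i f / 2 := by
  by_cases h : BoolCube.deriv i f = 0
  · rw [h, weight_zero]
    have := infl_nonneg i f
    positivity
  · have := schwartz_zippel h (P := fun x => BoolCube.deriv i f x ^ 2) (fun x => sq_nonneg _) (by
      intro x hx
      rcases hf.deriv i x with h1 | h1 | h1
      · exact absurd h1 hx
      · simp [h1]
      · simp [h1])
    rw [weight_of_ne_zero h, infl, pow_succ]
    linarith

lemma IsBool.totalWeight_le {f : (ι → ℤˣ) → ℝ} (hf : IsBool f) :
    totalWeight f ≤ totalInfl f / 2 := by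
  rw [totalWeight, totalInfl, sum_div]
  exact sum_le_sum fun i _ => hf.weight_le_infl i

lemma infl_eq (i : ι) (f : (ι → ℤˣ) → ℝ) :
    infl i f = ∑ S, if i ∈ S then coef f S ^ 2 else 0 := by
  have h : ∀ x, deriv i f x ^ 2 =
      (1 / 2 * (f x - f (x * flipSet {i}))) * (1 / 2 * (f x - f (x * flipSet {i}))) := by
    intro x
    unfold deriv
    linear_combination ((f x - f (x * flipSet {i})) / 2) ^ 2 * unit_sq (x i)
  unfold infl
  simp only [h]
  rw [parseval_mul (fun x => 1 / 2 * (f x - f (x * flipSet {i})))]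
  refine sum_congr rfl fun S _ => ?_
  rw [coef_const_mul, coef_sub, coef_translate, chi_flipSet_singleton]
  split_ifs <;> ring

lemma totalInfl_eq (f : (ι → ℤˣ) → ℝ) : totalInfl f = ∑ S, #S * coef f S ^ 2 := by
  unfold totalInfl
  simp only [infl_eq]
  rw [sum_comm]
  refine sum_congr rfl fun S _ => ?_
  simp

lemma IsBool.sum_coef_sq {f : (ι → ℤˣ) → ℝ} (hf : IsBool f) : ∑ S, coef f S ^ 2 = 1 := by
  have h : ∀ x, f x * f x = 1 := by
    intro x
    rcases hf x with h | h <;> simp [h]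
  have := parseval_mul f f
  simp only [h, ← sq] at this
  simpa using this.symm

lemma IsBool.totalInfl_le {f : (ι → ℤˣ) → ℝ} (hf : IsBool f) {d : ℕ} (hd : DegLE f d) :
    totalInfl f ≤ d := by
  rw [totalInfl_eq]
  calc ∑ S, #S * coef f S ^ 2 ≤ ∑ S, d * coef f S ^ 2 := by
        refine sum_le_sum fun S _ => ?_
        by_cases h : d < #S
        · rw [hd S h]
          simp
        · have : (#S : ℝ) ≤ d := by exact_mod_cast not_lt.1 h
          gcongr
    _ = d := by rw [← mul_sum, hf.sum_coef_sq, mul_one]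

lemma abs_coef_le (f : (ι → ℤˣ) → ℝ) (S : Finset ι) : |coef f S| ≤ 𝔼 x, |f x| := by
  unfold coef
  refine (abs_expect_le _ _).trans (le_of_eq (expect_congr rfl fun x _ => ?_))
  rw [abs_mul, abs_chi, mul_one]

lemma deriv_of_degLE_one {f : (ι → ℤˣ) → ℝ} (h : DegLE f 1) (t : ι) (x : ι → ℤˣ) :
    deriv t f x = coef f {t} := by
  have : deriv t f = fun x => coef f {t} * chi ∅ x := by
    refine ext_coef fun T => ?_
    rw [coef_deriv, coef_const_mul, coef_chi]
    by_cases hT : T = ∅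
    · subst hT
      simp
    · rw [if_neg (Ne.symm hT), mul_zero]
      split_ifs with ht
      · rfl
      · have := card_pos.2 (nonempty_iff_ne_empty.2 hT)
        exact h _ (by rw [card_insert_of_notMem ht]; omega)
  simp only [this, chi_empty, mul_one]

lemma coef_symmDiff_eq_zero {f : (ι → ℤˣ) → ℝ} (h : DegLE f 1) {A B C : Finset ι} (hA : #A ≤ 1)
    (hB : #B ≤ 1) (hC : #C ≤ 1) (hAB : A ≠ B) (hAC : A ≠ C) (hBC : B ≠ C) :
    coef f (A ∆ B ∆ C) = 0 := by
  have hd : ∀ S T : Finset ι, #S ≤ 1 → #T ≤ 1 → S ≠ T → Disjoint S T := by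
    intro S T hS hT hST
    rw [Finset.disjoint_left]
    intro a haS haT
    refine hST ?_
    ext b
    constructor
    · intro hb
      rwa [card_le_one.1 hS b hb a haS]
    · intro hb
      rwa [card_le_one.1 hT b hb a haT]
  have dAB := hd A B hA hB hAB
  have dC : Disjoint (A ∪ B) C :=
    disjoint_union_left.2 ⟨hd A C hA hC hAC, hd B C hB hC hBC⟩
  refine h _ ?_
  rw [dAB.symmDiff_eq_sup, sup_eq_union, dC.symmDiff_eq_sup, sup_eq_union,
    card_union_of_disjoint dC, card_union_of_disjoint dAB]
  by_contra hc
  have : #A = 0 ∧ #B = 0 ∨ #A = 0 ∧ #C = 0 ∨ #B = 0 ∧ #C = 0 := by omega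
  simp only [card_eq_zero] at this
  rcases this with ⟨h1, h2⟩ | ⟨h1, h2⟩ | ⟨h1, h2⟩
  · exact hAB (h1.trans h2.symm)
  · exact hAC (h1.trans h2.symm)
  · exact hBC (h1.trans h2.symm)

/-- An affine function with odd integer values and small `L¹` norm is a signed character. -/
lemma affine_odd {f : (ι → ℤˣ) → ℝ} (h : DegLE f 1) (hodd : ∀ x, ∃ z : ℤ, Odd z ∧ f x = z)
    (hE : 𝔼 x, |f x| < 3 / 2) :
    ∃ U : Finset ι, #U ≤ 1 ∧ ∃ s : ℝ, (s = 1 ∨ s = -1) ∧ ∀ x, f x = s * chi U x := by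
  classical
  have hint : ∀ U : Finset ι, U ≠ ∅ → coef f U ∈ (Int.castRingHom ℝ).range := by
    intro U hU
    by_cases hc : 1 < #U
    · rw [h U hc]
      exact zero_mem _
    · have hU1 : #U = 1 := by
        have := card_pos.2 (nonempty_iff_ne_empty.2 hU)
        omega
      obtain ⟨t, rfl⟩ := card_eq_one.1 hU1
      rw [← deriv_of_degLE_one h t 1]
      obtain ⟨a, ⟨a', ha'⟩, ha⟩ := hodd 1
      obtain ⟨b, ⟨b', hb'⟩, hb⟩ := hodd (1 * flipSet {t})
      refine ⟨a' - b', ?_⟩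
      rw [deriv, ha, hb, ha', hb']
      push_cast
      simp
      ring
  have hf1 : f 1 = ∑ U, coef f U := by
    rw [fourier f 1]
    simp [chi]
  have hint' : ∀ U : Finset ι, coef f U ∈ (Int.castRingHom ℝ).range := by
    intro U
    by_cases hU : U = ∅
    · have h1 : coef f U = f 1 - ∑ V ∈ univ.erase U, coef f V := by
        rw [hf1, ← add_sum_erase _ _ (mem_univ U)]
        ring
      rw [h1]
      refine sub_mem ?_ (sum_mem fun V hV => hint V ?_)
      · obtain ⟨a, -, ha⟩ := hodd 1
        exact ⟨a, by simp [ha]⟩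
      · rw [← hU]
        exact ne_of_mem_erase hV
    · exact hint U hU
  choose z hz using hint'
  simp only [eq_intCast] at hz
  have hz1 : ∀ U, z U = 0 ∨ z U = 1 ∨ z U = -1 := by
    intro U
    have h1 := (abs_coef_le f U).trans_lt hE
    rw [← hz, ← Int.cast_abs] at h1
    have h2 : |z U| < 2 := by
      have : ((|z U| : ℤ) : ℝ) < ((2 : ℤ) : ℝ) := by
        push_cast
        push_cast at h1
        linarith
      exact_mod_cast this
    rw [abs_lt] at h2
    omega
  set A : Finset (Finset ι) := univ.filter fun U => z U ≠ 0 with hA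
  have hAmem : ∀ U, U ∈ A ↔ z U ≠ 0 := by simp [hA]
  have hcard : ∀ U ∈ A, #U ≤ 1 := by
    intro U hU
    by_contra hc
    rw [hAmem] at hU
    have := hz U
    rw [h U (by omega)] at this
    exact hU (by exact_mod_cast this)
  have hAodd : Odd (#A : ℤ) := by
    obtain ⟨a, ha1, ha2⟩ := hodd 1
    have h1 : a = ∑ U, z U := by
      have : (a : ℝ) = ((∑ U, z U : ℤ) : ℝ) := by
        rw [← ha2, hf1]
        push_cast
        simp only [hz]
      exact_mod_cast this
    have h2 : (#A : ℤ) = ∑ U, |z U| := by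
      rw [hA, card_filter]
      push_cast
      refine sum_congr rfl fun U _ => ?_
      rcases hz1 U with h | h | h <;> simp [h]
    have h3 : Even (∑ U, |z U| - ∑ U, z U) := by
      rw [← sum_sub_distrib]
      refine even_sum _ fun U _ => ?_
      rcases hz1 U with h | h | h <;> simp [h]
    rw [h2]
    have := h3.add_odd (h1 ▸ ha1)
    simpa using this
  have hlt : ¬ 2 < #A := by
    intro h3
    obtain ⟨U, hU, V, hV, W, hW, hUV, hUW, hVW⟩ := two_lt_card.1 h3
    have hs : ∀ U ∈ A, z U = 1 ∨ z U = -1 := fun U hU =>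
      (hz1 U).resolve_left ((hAmem U).1 hU)
    set φ : (ι → ℤˣ) → ℝ := fun x => (z U * chi U x + z V * chi V x + z W * chi W x
      - (z U * z V * z W) * chi (U ∆ V ∆ W) x) / 2 with hφ
    have hφ1 : ∀ x, |φ x| ≤ 1 := by
      intro x
      simp only [hφ, ← chi_mul_chi]
      rcases hs U hU with h1 | h1 <;> rcases hs V hV with h2 | h2 <;>
        rcases hs W hW with h3 | h3 <;> rcases chi_eq_one_or U x with h4 | h4 <;>
        rcases chi_eq_one_or V x with h5 | h5 <;> rcases chi_eq_one_or W x with h6 | h6 <;>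
        rw [h1, h2, h3, h4, h5, h6] <;> norm_num
    have hE1 : 𝔼 x, f x * φ x ≤ 𝔼 x, |f x| := by
      refine expect_le_expect fun x _ => (le_abs_self _).trans ?_
      rw [abs_mul]
      exact mul_le_of_le_one_right (abs_nonneg _) (hφ1 x)
    have hE2 : 𝔼 x, f x * φ x = (z U * coef f U + z V * coef f V + z W * coef f W
        - (z U * z V * z W) * coef f (U ∆ V ∆ W)) / 2 := by
      have : ∀ x, f x * φ x = (z U * (f x * chi U x) + z V * (f x * chi V x)
          + z W * (f x * chi W x) - (z U * z V * z W) * (f x * chi (U ∆ V ∆ W) x)) / 2 := by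
        intro x
        simp only [hφ]
        ring
      simp only [this]
      rw [← expect_div, expect_sub_distrib, expect_add_distrib, expect_add_distrib,
        ← mul_expect, ← mul_expect, ← mul_expect, ← mul_expect]
      rfl
    rw [coef_symmDiff_eq_zero h (hcard U hU) (hcard V hV) (hcard W hW) hUV hUW hVW, ← hz, ← hz,
      ← hz] at hE2
    have hsq : ∀ U ∈ A, (z U : ℝ) * z U = 1 := by
      intro U hU
      rcases hs U hU with h | h <;> simp [h]
    rw [hsq U hU, hsq V hV, hsq W hW] at hE2
    linarith
  have hA1 : #A = 1 := by
    obtain ⟨r, hr⟩ := hAodd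
    omega
  obtain ⟨U, hU⟩ := card_eq_one.1 hA1
  have hUA : U ∈ A := by simp [hU]
  refine ⟨U, hcard U hUA, z U, ?_, fun x => ?_⟩
  · rcases (hz1 U).resolve_left ((hAmem U).1 hUA) with h | h <;> simp [h]
  · rw [fourier f x, sum_eq_single U]
    · rw [hz]
    · intro V _ hV
      have : V ∉ A := by simp [hU, hV]
      rw [hAmem, not_not] at this
      rw [← hz, this]
      simp
    · simp

end

lemma sum_ternary {α : Type*} (P : Finset α) (a : α → ℝ)
    (h : ∀ i, a i = 0 ∨ a i = 1 ∨ a i = -1) :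
    ∃ n z : ℤ, ∑ i ∈ P, a i ^ 2 = n ∧ ∑ i ∈ P, a i = z ∧ Even (n - z) ∧ |z| ≤ n := by
  classical
  induction P using Finset.induction_on with
  | empty => exact ⟨0, 0, by simp⟩
  | insert i P hi ih =>
    obtain ⟨n, z, h1, h2, h3, h4⟩ := ih
    rw [sum_insert hi, sum_insert hi, h1, h2]
    rw [abs_le] at h4
    rcases h i with h0 | h0 | h0 <;> rw [h0]
    · exact ⟨n, z, by simp, by simp, h3, abs_le.2 h4⟩
    · exact ⟨n + 1, z + 1, by push_cast; ring, by push_cast; ring, by simpa using h3,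
        abs_le.2 ⟨by omega, by omega⟩⟩
    · refine ⟨n + 1, z - 1, by push_cast; ring, by push_cast; ring, ?_,
        abs_le.2 ⟨by omega, by omega⟩⟩
      obtain ⟨r, hr⟩ := h3
      exact ⟨r + 1, by omega⟩

section

variable {ι : Type*} [Fintype ι] [DecidableEq ι]

lemma DegLE.mul {f g : (ι → ℤˣ) → ℝ} {a b : ℕ} (hf : DegLE f a) (hg : DegLE g b) :
    DegLE (fun x => f x * g x) (a + b) := by
  intro S hS
  rw [coef_mul]
  refine sum_eq_zero fun T _ => ?_
  by_cases hT : a < #T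
  · rw [hf T hT, zero_mul]
  · rw [hg _ ?_, mul_zero]
    by_contra hc
    have h1 : S ⊆ (S ∆ T) ∪ T := by
      intro i hi
      by_cases hiT : i ∈ T <;> simp [mem_symmDiff, hi, hiT]
    have h2 := (card_le_card h1).trans (card_union_le _ _)
    omega

lemma DegLE.prod {P : Finset ι} {F : ι → (ι → ℤˣ) → ℝ} (h : ∀ i ∈ P, DegLE (F i) 1) :
    DegLE (fun x => ∏ i ∈ P, F i x) #P := by
  induction P using Finset.induction_on with
  | empty =>
    intro S hS
    have : coef (chi (∅ : Finset ι)) S = 0 := by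
      rw [coef_chi, if_neg]
      rintro rfl
      simp at hS
    rwa [show chi (∅ : Finset ι) = fun x => ∏ i ∈ ∅, F i x from rfl] at this
  | insert i P hi ih =>
    simp only [prod_insert hi, card_insert_of_notMem hi]
    rw [add_comm]
    exact (h i (mem_insert_self _ _)).mul (ih fun j hj => h j (mem_insert_of_mem hj))

lemma DegLE.const_mul {f : (ι → ℤˣ) → ℝ} {d : ℕ} (h : DegLE f d) (c : ℝ) :
    DegLE (fun x => c * f x) d := by
  intro S hS
  rw [coef_const_mul, h S hS, mul_zero]

lemma DegLE.sub {f g : (ι → ℤˣ) → ℝ} {d : ℕ} (hf : DegLE f d) (hg : DegLE g d) :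
    DegLE (fun x => f x - g x) d := by
  intro S hS
  rw [coef_sub, hf S hS, hg S hS, sub_zero]

lemma DegLE.add {f g : (ι → ℤˣ) → ℝ} {d : ℕ} (hf : DegLE f d) (hg : DegLE g d) :
    DegLE (fun x => f x + g x) d := by
  intro S hS
  rw [coef_add, hf S hS, hg S hS, add_zero]

lemma degLE_chi {U : Finset ι} {d : ℕ} (h : #U ≤ d) : DegLE (chi U) d := by
  intro S hS
  rw [coef_chi, if_neg]
  rintro rfl
  omega

omit [Fintype ι] in
lemma powerset_sum_flipSet {β : Type*} [AddCommMonoid β] {M S : Finset ι} (hS : S ⊆ M)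
    (F : (ι → ℤˣ) → β) (x : ι → ℤˣ) :
    ∑ T ∈ M.powerset, F (x * flipSet S * flipSet T) = ∑ T ∈ M.powerset, F (x * flipSet T) := by
  have hsub : ∀ T ∈ M.powerset, S ∆ T ∈ M.powerset := by
    intro T hT
    rw [mem_powerset] at hT ⊢
    exact symmDiff_le (hS.trans le_sup_right) (hT.trans le_sup_right)
  refine sum_nbij' (fun T => S ∆ T) (fun T => S ∆ T) hsub hsub ?_ ?_ ?_
  · intro T _
    exact symmDiff_symmDiff_cancel_left S T
  · intro T _
    exact symmDiff_symmDiff_cancel_left S T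
  · intro T _
    rw [mul_assoc, flipSet_mul_flipSet]

omit [Fintype ι] in
lemma flipSum_flipSet {M S : Finset ι} (hS : S ⊆ M) (N : Finset ι) (g : (ι → ℤˣ) → ℝ)
    (x : ι → ℤˣ) : flipSum M N g (x * flipSet S) = flipSum M N g x :=
  powerset_sum_flipSet hS (fun x => g x * chi N x) x

lemma degLE_flipSum_erase {g : (ι → ℤˣ) → ℝ} {M : Finset ι} (h : DegLE g #M) {m : ι}
    (hm : m ∈ M) : DegLE (flipSum M (M.erase m) g) 1 := by
  intro T hT
  rw [coef_flipSum]
  split_ifs with hd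
  · rw [h, mul_zero]
    have hd' : Disjoint T (M.erase m) := hd.mono_right (erase_subset _ _)
    rw [hd'.symmDiff_eq_sup, sup_eq_union, card_union_of_disjoint hd', card_erase_of_mem hm]
    have := card_pos.2 ⟨m, hm⟩
    omega
  · rfl

omit [Fintype ι] [DecidableEq ι] in
lemma ternary_mul_chi {a : ℝ} (h : a = 0 ∨ a = 1 ∨ a = -1) (N : Finset ι) (x : ι → ℤˣ) :
    a * chi N x = 0 ∨ a * chi N x = 1 ∨ a * chi N x = -1 := by
  rcases h with h | h | h <;> rcases chi_eq_one_or N x with h' | h' <;> rw [h, h'] <;> norm_num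

section Gap

variable {g : (ι → ℤˣ) → ℝ} {M : Finset ι}

omit [Fintype ι] in
lemma flipSum_parity (hg : ∀ x, g x = 0 ∨ g x = 1 ∨ g x = -1) (N : Finset ι) (x : ι → ℤˣ) :
    ∃ n z : ℤ, ∑ S ∈ M.powerset, g (x * flipSet S) ^ 2 = n ∧ flipSum M N g x = z ∧
      Even (n - z) ∧ |z| ≤ n := by
  obtain ⟨n, z, h1, h2, h3⟩ := sum_ternary M.powerset
    (fun S => g (x * flipSet S) * chi N (x * flipSet S))
    (fun S => ternary_mul_chi (hg _) N _)
  refine ⟨n, z, ?_, h2, h3⟩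
  rw [← h1]
  refine sum_congr rfl fun S _ => ?_
  linear_combination (-(g (x * flipSet S)) ^ 2) * chi_mul_self N (x * flipSet S)

lemma gap_top (hg : ∀ x, g x = 0 ∨ g x = 1 ∨ g x = -1) (hdeg : DegLE g #M)
    (hM : coef g M ≠ 0) (hE : 𝔼 x, g x ^ 2 < 3 / 2 * (1 / 2) ^ #M) :
    (2 ^ #M * coef g M = 1 ∨ 2 ^ #M * coef g M = -1) ∧
    (∀ x, ∃ n : ℤ, Odd n ∧ 1 ≤ n ∧ ∑ S ∈ M.powerset, g (x * flipSet S) ^ 2 = n) ∧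
    𝔼 x, ∑ S ∈ M.powerset, g (x * flipSet S) ^ 2 < 3 / 2 := by
  have hEN : 𝔼 x, ∑ S ∈ M.powerset, g (x * flipSet S) ^ 2 < 3 / 2 := by
    rw [expect_sum_flipSet M (fun x => g x ^ 2)]
    calc (2 : ℝ) ^ #M * 𝔼 x, g x ^ 2 < 2 ^ #M * (3 / 2 * (1 / 2) ^ #M) := by gcongr
      _ = 3 / 2 * (2 * (1 / 2)) ^ #M := by rw [mul_pow]; ring
      _ = 3 / 2 := by norm_num
  obtain ⟨x0, hx0⟩ : ∃ x, ∑ S ∈ M.powerset, g (x * flipSet S) ^ 2 < 3 / 2 := by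
    by_contra! hc
    exact absurd hEN (not_lt.2 (le_expect univ_nonempty fun x _ => hc x))
  have hc : 2 ^ #M * coef g M = 1 ∨ 2 ^ #M * coef g M = -1 := by
    obtain ⟨n, z, h1, h2, h3, h4⟩ := flipSum_parity (M := M) hg M x0
    rw [flipSum_self hdeg] at h2
    have hn : n < 2 := by
      have : (n : ℝ) < 2 := by
        rw [← h1]
        linarith
      exact_mod_cast this
    have hz : z ≠ 0 := by
      rintro rfl
      rw [Int.cast_zero, mul_eq_zero] at h2
      rcases h2 with h2 | h2
      · exact absurd h2 (by positivity)
      · exact hM h2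
    rw [h2]
    rw [abs_le] at h4
    have : z = 1 ∨ z = -1 := by omega
    rcases this with h | h <;> simp [h]
  refine ⟨hc, fun x => ?_, hEN⟩
  obtain ⟨n, z, h1, h2, h3, h4⟩ := flipSum_parity (M := M) hg M x
  rw [flipSum_self hdeg] at h2
  have hz : z = 1 ∨ z = -1 := by
    rcases hc with h | h <;> rw [h] at h2
    · left
      exact_mod_cast h2.symm
    · right
      exact_mod_cast h2.symm
  refine ⟨n, ?_, ?_, h1⟩
  · have : Odd z := by rcases hz with h | h <;> simp [h]
    simpa using h3.add_odd this
  · rw [abs_le] at h4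
    omega

lemma gap_character (hg : ∀ x, g x = 0 ∨ g x = 1 ∨ g x = -1) (hdeg : DegLE g #M)
    (hM : coef g M ≠ 0) (hE : 𝔼 x, g x ^ 2 < 3 / 2 * (1 / 2) ^ #M) {m : ι} (hm : m ∈ M) :
    ∃ U : Finset ι, #U ≤ 1 ∧ ∃ s : ℝ, (s = 1 ∨ s = -1) ∧
      ∀ x, flipSum M (M.erase m) g x = s * chi U x := by
  obtain ⟨-, hN, hEN⟩ := gap_top hg hdeg hM hE
  refine affine_odd (degLE_flipSum_erase hdeg hm) (fun x => ?_) (lt_of_le_of_lt ?_ hEN)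
  · obtain ⟨n, z, h1, h2, h3, h4⟩ := flipSum_parity (M := M) hg (M.erase m) x
    obtain ⟨n', ho, -, hn'⟩ := hN x
    have : n = n' := by
      rw [h1] at hn'
      exact_mod_cast hn'
    subst this
    refine ⟨z, ?_, h2⟩
    have := ho.sub_even h3
    simpa using this
  · refine expect_le_expect fun x _ => ?_
    obtain ⟨n, z, h1, h2, h3, h4⟩ := flipSum_parity (M := M) hg (M.erase m) x
    rw [h1, h2]
    exact_mod_cast h4

/-- The candidate product formula. -/
noncomputable def gapProd (M : Finset ι) (g : (ι → ℤˣ) → ℝ) (c : ℝ) : (ι → ℤˣ) → ℝ :=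
  fun x => c * ∏ m ∈ M, (((x m : ℤ) : ℝ) + c * flipSum M (M.erase m) g x) / 2

omit [Fintype ι] in
lemma units_eq_neg_of_ne {a b : ℤˣ} (h : a ≠ b) : ((a : ℤ) : ℝ) + ((b : ℤ) : ℝ) = 0 := by
  rcases Int.units_eq_one_or a with h1 | h1 <;> rcases Int.units_eq_one_or b with h2 | h2 <;>
    simp [h1, h2] at h ⊢

lemma gapProd_eq_of_sum_eq_one (hdeg : DegLE g #M)
    {c : ℝ} (hc : 2 ^ #M * coef g M = c) (hc2 : c * c = 1)
    {x : ι → ℤˣ} (hx : ∃ S ∈ M.powerset, g (x * flipSet S) ≠ 0 ∧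
      ∀ T ∈ M.powerset, T ≠ S → g (x * flipSet T) = 0) : g x = gapProd M g c x := by
  obtain ⟨S, hS, hgS, hT⟩ := hx
  have key : ∀ N, flipSum M N g x = g (x * flipSet S) * chi N (x * flipSet S) := by
    intro N
    refine sum_eq_single_of_mem S hS fun T hTM hTS => ?_
    rw [hT T hTM hTS, zero_mul]
  have hcS : c = g (x * flipSet S) * chi M (x * flipSet S) := by
    rw [← key M, flipSum_self hdeg, hc]
  have hm : ∀ m ∈ M, c * flipSum M (M.erase m) g x = (((x * flipSet S) m : ℤ) : ℝ) := by
    intro m hm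
    have h1 : chi M (x * flipSet S) =
        (((x * flipSet S) m : ℤ) : ℝ) * chi (M.erase m) (x * flipSet S) :=
      (mul_prod_erase M _ hm).symm
    rw [key]
    have h2 : g (x * flipSet S) * chi (M.erase m) (x * flipSet S) =
        c * (((x * flipSet S) m : ℤ) : ℝ) := by
      rw [hcS, h1]
      linear_combination (-(g (x * flipSet S) * chi (M.erase m) (x * flipSet S))) *
        unit_sq ((x * flipSet S) m)
    rw [h2]
    linear_combination (((x * flipSet S) m : ℤ) : ℝ) * hc2
  have hP : gapProd M g c x =
      c * ∏ m ∈ M, (((x m : ℤ) : ℝ) + (((x * flipSet S) m : ℤ) : ℝ)) / 2 := by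
    unfold gapProd
    congr 1
    exact prod_congr rfl fun m h => by rw [hm m h]
  rw [hP]
  by_cases hS0 : S = ∅
  · subst hS0
    simp only [flipSet_empty, mul_one] at hcS ⊢
    have : ∏ m ∈ M, (((x m : ℤ) : ℝ) + ((x m : ℤ) : ℝ)) / 2 = chi M x :=
      prod_congr rfl fun m _ => by ring
    rw [this, hcS]
    linear_combination (-g x) * chi_mul_self M x
  · obtain ⟨i, hi⟩ := nonempty_iff_ne_empty.2 hS0
    rw [prod_eq_zero (mem_powerset.1 hS hi), mul_zero]
    · have := hT ∅ (by simp) (Ne.symm hS0)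
      simpa [flipSet_empty] using this
    · rw [mul_flipSet_apply_of_mem hi]
      simp

omit [Fintype ι] in
lemma gapProd_ne_zero_unique {c : ℝ} {x : ι → ℤˣ}
    (hL : ∀ m ∈ M, ∃ a : ℤˣ, c * flipSum M (M.erase m) g x = ((a : ℤ) : ℝ)) {S T : Finset ι}
    (hS : S ⊆ M) (hT : T ⊆ M) (hS1 : gapProd M g c (x * flipSet S) ≠ 0)
    (hT1 : gapProd M g c (x * flipSet T) ≠ 0) : S = T := by
  have key : ∀ S ⊆ M, gapProd M g c (x * flipSet S) ≠ 0 → ∀ m ∈ M, ∀ a : ℤˣ,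
      c * flipSum M (M.erase m) g x = ((a : ℤ) : ℝ) → (x * flipSet S) m = a := by
    intro S hS h m hm a ha
    have h1 := right_ne_zero_of_mul h
    rw [prod_ne_zero_iff] at h1
    have h2 := h1 m hm
    rw [flipSum_flipSet hS, ha] at h2
    by_contra h3
    rw [units_eq_neg_of_ne h3] at h2
    simp at h2
  have hne : ∀ u : ℤˣ, - u ≠ u := by decide
  ext m
  by_cases hm : m ∈ M
  · obtain ⟨a, ha⟩ := hL m hm
    have e1 := key S hS hS1 m hm a ha
    have e2 := key T hT hT1 m hm a ha
    by_cases h1 : m ∈ S <;> by_cases h2 : m ∈ T <;> simp only [h1, h2]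
    · rw [mul_flipSet_apply_of_mem h1] at e1
      rw [mul_flipSet_apply_of_notMem h2] at e2
      exact absurd (e1.trans e2.symm) (hne _)
    · rw [mul_flipSet_apply_of_notMem h1] at e1
      rw [mul_flipSet_apply_of_mem h2] at e2
      exact absurd (e2.trans e1.symm) (hne _)
  · exact iff_of_false (fun h => hm (hS h)) (fun h => hm (hT h))

lemma degLE_gapProd (hdeg : DegLE g #M) (c : ℝ) : DegLE (gapProd M g c) #M := by
  refine DegLE.const_mul (DegLE.prod fun m hm => ?_) c
  have h1 : DegLE (fun x => 1 / 2 * (chi {m} x + c * flipSum M (M.erase m) g x)) 1 :=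
    ((degLE_chi (by simp)).add ((degLE_flipSum_erase hdeg hm).const_mul c)).const_mul _
  convert h1 using 2 with x
  rw [chi_singleton]
  ring

/-- A ternary function of degree `#M` with leading monomial `M` and small support is a product. -/
lemma eq_gapProd (hg : ∀ x, g x = 0 ∨ g x = 1 ∨ g x = -1) (hdeg : DegLE g #M)
    (hM : coef g M ≠ 0) (hE : 𝔼 x, g x ^ 2 < 3 / 2 * (1 / 2) ^ #M) :
    g = gapProd M g (2 ^ #M * coef g M) := by
  classical
  obtain ⟨hc, hN, hEN⟩ := gap_top hg hdeg hM hE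
  set c : ℝ := 2 ^ #M * coef g M with hcdef
  have hc2 : c * c = 1 := by rcases hc with h | h <;> rw [h] <;> norm_num
  have hL : ∀ x, ∀ m ∈ M, ∃ a : ℤˣ, c * flipSum M (M.erase m) g x = ((a : ℤ) : ℝ) := by
    intro x m hm
    obtain ⟨U, -, s, hs, hU⟩ := gap_character hg hdeg hM hE hm
    rw [hU]
    have : c * (s * chi U x) = 1 ∨ c * (s * chi U x) = -1 := by
      rcases hc with h | h <;> rcases hs with h' | h' <;> rcases chi_eq_one_or U x with h3 | h3 <;>
        rw [h, h', h3] <;> norm_num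
    rcases this with h | h
    · exact ⟨1, by simp [h]⟩
    · exact ⟨-1, by simp [h]⟩
  have hgood : ∀ x, ∑ S ∈ M.powerset, g (x * flipSet S) ^ 2 = 1 → g x = gapProd M g c x := by
    intro x hx
    refine gapProd_eq_of_sum_eq_one hdeg rfl hc2 ?_
    have h1 : ∑ S ∈ M.powerset, g (x * flipSet S) ^ 2 ≠ 0 := by
      rw [hx]
      norm_num
    obtain ⟨S, hS, hS2⟩ := exists_ne_zero_of_sum_ne_zero h1
    have hS3 : g (x * flipSet S) ≠ 0 := fun h => hS2 (by rw [h]; norm_num)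
    refine ⟨S, hS, hS3, fun T hT hTS => ?_⟩
    have hS4 : g (x * flipSet S) ^ 2 = 1 := by
      rcases (hg (x * flipSet S)).resolve_left hS3 with h | h <;> rw [h] <;> norm_num
    rw [← add_sum_erase _ _ hS, hS4] at hx
    have h2 : ∑ S ∈ M.powerset.erase S, g (x * flipSet S) ^ 2 = 0 := by linarith
    rw [sum_eq_zero_iff_of_nonneg fun _ _ => sq_nonneg _] at h2
    exact pow_eq_zero_iff (two_ne_zero) |>.1 (h2 T (mem_erase.2 ⟨hTS, hT⟩))
  by_contra hne
  set H : (ι → ℤˣ) → ℝ := fun x => g x - gapProd M g c x with hH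
  have hH0 : H ≠ 0 := fun h => hne (funext fun x => sub_eq_zero.1 (congrFun h x))
  have hHdeg : DegLE H #M := hdeg.sub (degLE_gapProd hdeg c)
  set P : (ι → ℤˣ) → ℝ := fun x => if H x = 0 then 0 else 1 with hP
  have hSZ := schwartz_zippel hH0 (P := P) (fun x => by simp only [hP]; split_ifs <;> norm_num)
    (fun x hx => by simp [hP, hx])
  have hbound : ∀ x, ∑ S ∈ M.powerset, P (x * flipSet S) ≤
      2 * (∑ S ∈ M.powerset, g (x * flipSet S) ^ 2 - 1) := by
    intro x
    obtain ⟨n, ho, hn1, hn⟩ := hN x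
    by_cases h1 : n = 1
    · have : ∀ S ∈ M.powerset, P (x * flipSet S) = 0 := by
        intro S hS
        have h2 : H (x * flipSet S) = 0 := by
          refine sub_eq_zero.2 (hgood _ ?_)
          rw [powerset_sum_flipSet (mem_powerset.1 hS) (fun x => g x ^ 2), hn, h1]
          simp
        simp [hP, h2]
      rw [sum_eq_zero this, hn, h1]
      simp
    · have hn3 : 3 ≤ n := by
        obtain ⟨r, hr⟩ := ho
        omega
      have hn3' : (3 : ℝ) ≤ n := by exact_mod_cast hn3
      have hP2 : ∀ S, P (x * flipSet S) ≤ g (x * flipSet S) ^ 2 +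
          if gapProd M g c (x * flipSet S) ≠ 0 then 1 else 0 := by
        intro S
        simp only [hP]
        split_ifs with h2 h3 h3
        · positivity
        · positivity
        · have := sq_nonneg (g (x * flipSet S))
          linarith
        · rw [not_not] at h3
          simp only [hH, h3, sub_zero] at h2
          rcases (hg (x * flipSet S)).resolve_left h2 with h | h <;> rw [h] <;> norm_num
      have hcard : ∑ S ∈ M.powerset,
          (if gapProd M g c (x * flipSet S) ≠ 0 then (1 : ℝ) else 0) ≤ 1 := by
        rw [sum_boole]
        have : #(M.powerset.filter fun S => gapProd M g c (x * flipSet S) ≠ 0) ≤ 1 := by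
          refine card_le_one.2 fun S hS T hT => ?_
          rw [mem_filter, mem_powerset] at hS hT
          exact gapProd_ne_zero_unique (hL x) hS.1 hT.1 hS.2 hT.2
        exact_mod_cast this
      have := sum_le_sum fun S (_ : S ∈ M.powerset) => hP2 S
      rw [sum_add_distrib, hn] at this
      rw [hn]
      linarith
  have h1 := expect_le_expect (s := univ) fun x _ => hbound x
  rw [expect_sum_flipSet, ← mul_expect, expect_sub_distrib, expect_const univ_nonempty] at h1
  have h2 : (1 : ℝ) ≤ 2 ^ #M * 𝔼 x, P x := by
    calc (1 : ℝ) = 2 ^ #M * (1 / 2) ^ #M := by rw [← mul_pow]; norm_num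
      _ ≤ 2 ^ #M * (1 / 2) ^ deg H := by
        gcongr ?_ * ?_
        exact pow_le_pow_of_le_one (by norm_num) (by norm_num) (deg_le_of_degLE hHdeg)
      _ ≤ _ := by gcongr
  linarith

end Gap

lemma flipSum_deriv {f : (ι → ℤˣ) → ℝ} {M : Finset ι} {i m : ι} (hi : i ∈ M)
    (him : i ≠ m) (x : ι → ℤˣ) :
    flipSum (M.erase i) ((M.erase i).erase m) (deriv i f) x =
      1 / 2 * flipSum M (M.erase m) f x := by
  have : flipSum (M.erase i) ((M.erase i).erase m) (deriv i f) =
      fun x => 1 / 2 * flipSum M (M.erase m) f x := by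
    refine ext_coef fun T => ?_
    rw [coef_flipSum, coef_const_mul, coef_flipSum, coef_deriv]
    by_cases hiT : i ∈ T
    · have h1 : ¬ Disjoint T M := fun h => Finset.disjoint_left.1 h hiT hi
      have h2 : i ∈ T ∆ ((M.erase i).erase m) := by simp [mem_symmDiff, hiT]
      rw [if_neg h1, if_pos h2]
      simp
    · have h1 : Disjoint T (M.erase i) ↔ Disjoint T M := by
        rw [← insert_erase hi, disjoint_insert_right, erase_insert (notMem_erase i M)]
        simp [hiT]
      have h2 : i ∉ T ∆ ((M.erase i).erase m) := by simp [mem_symmDiff, hiT]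
      have h3 : insert i (T ∆ ((M.erase i).erase m)) = T ∆ (M.erase m) := by
        ext j
        by_cases hj : j = i
        · subst hj
          simp [mem_symmDiff, hiT, hi, him]
        · simp [mem_symmDiff, hj]
      simp only [h1, h2, h3, if_false]
      split_ifs
      · rw [← card_erase_add_one hi, pow_succ]
        ring
      · ring
  rw [this]

omit [Fintype ι] in
lemma IsBool.eq_mul_deriv {f : (ι → ℤˣ) → ℝ} (hf : IsBool f) {i : ι} {x : ι → ℤˣ}
    (h : BoolCube.deriv i f x ≠ 0) : f x = ((x i : ℤ) : ℝ) * BoolCube.deriv i f x := by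
  unfold BoolCube.deriv at h ⊢
  have h1 := unit_sq (x i)
  have h2 : f (x * flipSet {i}) = - f x := by
    rcases hf x with h3 | h3 <;> rcases hf (x * flipSet {i}) with h4 | h4
    · simp [h3, h4] at h
    · rw [h3, h4]
    · rw [h3, h4, neg_neg]
    · simp [h3, h4] at h
  rw [h2]
  linear_combination (-f x) * h1

omit [Fintype ι] in
lemma deriv_flip_of_deriv_eq {f : (ι → ℤˣ) → ℝ} {i v : ι} (hiv : i ≠ v)
    (h : ∀ x, deriv i f (x * flipSet {v}) = deriv i f x) (x : ι → ℤˣ) :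
    f (x * flipSet {i}) - f (x * flipSet {i} * flipSet {v}) = f x - f (x * flipSet {v}) := by
  have h1 := h x
  unfold deriv at h1
  rw [mul_flipSet_apply_of_notMem (by simpa using hiv)] at h1
  have h2 : x * flipSet {v} * flipSet {i} = x * flipSet {i} * flipSet {v} := mul_right_comm _ _ _
  rw [h2] at h1
  linear_combination (2 * ((x i : ℤ) : ℝ)) * h1 - (f (x * flipSet {v}) -
    f (x * flipSet {i} * flipSet {v}) - f x + f (x * flipSet {i})) * unit_sq (x i)

omit [Fintype ι] in
lemma sub_flipSet_of_deriv_eq {f : (ι → ℤˣ) → ℝ} {M : Finset ι} {v : ι} (hv : v ∉ M)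
    (h : ∀ i ∈ M, ∀ x, deriv i f (x * flipSet {v}) = deriv i f x) {S : Finset ι} (hS : S ⊆ M)
    (x : ι → ℤˣ) :
    f (x * flipSet S) - f (x * flipSet S * flipSet {v}) = f x - f (x * flipSet {v}) := by
  induction S using Finset.induction_on with
  | empty => simp [flipSet_empty]
  | insert i S hi ih =>
    have hiM : i ∈ M := hS (mem_insert_self _ _)
    have h1 : flipSet (insert i S) = flipSet S * flipSet {i} := by
      rw [flipSet_mul_flipSet]
      congr 1
      ext j
      by_cases hj : j = i
      · subst hj
        simp [mem_symmDiff, hi]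
      · simp [mem_symmDiff, hj]
    rw [h1, ← mul_assoc, deriv_flip_of_deriv_eq (v := v) (ne_of_mem_of_not_mem hiM hv) (h i hiM),
      ih fun j hj => hS (mem_insert_of_mem hj)]

lemma IsBool.totalWeight_le_one {f : (ι → ℤˣ) → ℝ} (hf : IsBool f) {M : Finset ι}
    (hdeg : DegLE f #M) (hd : 2 ≤ #M) (hM : coef f M ≠ 0)
    (hI : ∀ i ∈ M, infl i f < 3 * (1 / 2) ^ #M) : totalWeight f ≤ 1 := by
  set c : ℝ := 2 ^ (#M - 1) * coef f M with hc
  set L : ι → (ι → ℤˣ) → ℝ := fun m x => 1 / 2 * flipSum M (M.erase m) f x with hL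
  have hcard : ∀ i ∈ M, #(M.erase i) = #M - 1 := fun i hi => card_erase_of_mem hi
  have hpow : ((1 : ℝ) / 2) ^ #M = (1 / 2) ^ (#M - 1) / 2 := by
    obtain ⟨e, he⟩ : ∃ e, #M = e + 1 := ⟨#M - 1, by omega⟩
    rw [he, pow_succ, Nat.add_sub_cancel]
    ring
  have hcoef : ∀ i ∈ M, coef (BoolCube.deriv i f) (M.erase i) = coef f M := by
    intro i hi
    rw [coef_deriv, if_neg (notMem_erase i M), insert_erase hi]
  have hgdeg : ∀ i ∈ M, DegLE (BoolCube.deriv i f) #(M.erase i) := by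
    intro i hi
    rw [hcard i hi]
    exact hdeg.deriv i
  have hgE : ∀ i ∈ M, 𝔼 x, BoolCube.deriv i f x ^ 2 < 3 / 2 * (1 / 2) ^ #(M.erase i) := by
    intro i hi
    have := hI i hi
    rw [hpow, infl] at this
    rw [hcard i hi]
    linarith
  have hform : ∀ i ∈ M, ∀ x, BoolCube.deriv i f x =
      c * ∏ m ∈ M.erase i, (((x m : ℤ) : ℝ) + c * L m x) / 2 := by
    intro i hi x
    have h1 := eq_gapProd (hf.deriv i) (hgdeg i hi) (by rwa [hcoef i hi]) (hgE i hi)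
    rw [hcoef i hi, hcard i hi, ← hc] at h1
    rw [h1]
    unfold gapProd
    congr 1
    refine prod_congr rfl fun m hm => ?_
    rw [flipSum_deriv hi (ne_of_mem_erase hm).symm]
  have hother : ∀ m ∈ M, ∃ i ∈ M, m ∈ M.erase i := by
    intro m hm
    obtain ⟨i, hi, him⟩ := exists_mem_ne hd m
    exact ⟨i, hi, mem_erase.2 ⟨him.symm, hm⟩⟩
  have hchar : ∀ m ∈ M, ∃ U : Finset ι, #U ≤ 1 ∧ ∃ s : ℝ, (s = 1 ∨ s = -1) ∧
      ∀ x, L m x = s * chi U x := by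
    intro m hm
    obtain ⟨i, hi, hmi⟩ := hother m hm
    have := gap_character (hf.deriv i) (hgdeg i hi) (by rwa [hcoef i hi]) (hgE i hi) hmi
    simpa only [flipSum_deriv hi (ne_of_mem_erase hmi).symm] using this
  have hc1 : c = 1 ∨ c = -1 := by
    obtain ⟨i, hi⟩ : M.Nonempty := card_pos.1 (by omega)
    have := (gap_top (hf.deriv i) (hgdeg i hi) (by rwa [hcoef i hi]) (hgE i hi)).1
    rwa [hcoef i hi, hcard i hi] at this
  choose! U hU1 s hs hLU using hchar
  have hUcoef : ∀ m ∈ M, Disjoint (U m) M ∧ coef f (U m ∆ M.erase m) ≠ 0 := by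
    intro m hm
    have h1 : coef (L m) (U m) = s m := by
      rw [show L m = fun x => s m * chi (U m) x from funext (hLU m hm), coef_const_mul, coef_chi]
      simp
    have h2 : coef (L m) (U m) ≠ 0 := by
      rw [h1]
      rcases hs m hm with h | h <;> rw [h] <;> norm_num
    rw [show L m = fun x => 1 / 2 * flipSum M (M.erase m) f x from rfl, coef_const_mul,
      coef_flipSum] at h2
    split_ifs at h2 with hd
    · exact ⟨hd, right_ne_zero_of_mul (right_ne_zero_of_mul h2)⟩
    · simp at h2
  set V := M ∪ M.biUnion U with hV
  have hVcard : #V ≤ 2 * #M := by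
    have h1 : #(M.biUnion U) ≤ #M * 1 := card_biUnion_le_card_mul _ _ _ hU1
    have h2 := card_union_le M (M.biUnion U)
    rw [← hV] at h2
    omega
  have hVw : ∀ v ∈ V, weight (BoolCube.deriv v f) ≤ (1 / 2) ^ #M := by
    intro v hv
    rw [hV, mem_union, mem_biUnion] at hv
    rcases hv with hv | ⟨m, hm, hv⟩
    · have := weight_le_of_coef (f := BoolCube.deriv v f) (S := M.erase v) (by rwa [hcoef v hv])
      rwa [card_erase_add_one hv] at this
    · obtain ⟨h1, h2⟩ := hUcoef m hm
      have hdis : Disjoint (U m) (M.erase m) := h1.mono_right (erase_subset _ _)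
      rw [hdis.symmDiff_eq_sup, sup_eq_union] at h2
      have hvmem : v ∈ U m ∪ M.erase m := mem_union_left _ hv
      have := weight_le_of_coef (f := BoolCube.deriv v f) (S := (U m ∪ M.erase m).erase v) (by
        rwa [coef_deriv, if_neg (notMem_erase _ _), insert_erase hvmem])
      rw [card_erase_add_one hvmem, card_union_of_disjoint hdis, hcard m hm] at this
      have h3 : #(U m) = 1 := le_antisymm (hU1 m hm) (card_pos.2 ⟨v, hv⟩)
      rwa [h3, Nat.add_sub_cancel' (by omega)] at this
  have hVz : ∀ v, v ∉ V → BoolCube.deriv v f = 0 := by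
    intro v hv
    rw [hV, mem_union, mem_biUnion, not_or] at hv
    obtain ⟨hvM, hvU⟩ := hv
    push Not at hvU
    have hLv : ∀ m ∈ M, ∀ x, L m (x * flipSet {v}) = L m x := by
      intro m hm x
      rw [hLU m hm, hLU m hm, chi_mul, chi_flipSet_singleton, if_neg (hvU m hm), mul_one]
    have hDv : ∀ i ∈ M, ∀ x, BoolCube.deriv i f (x * flipSet {v}) = BoolCube.deriv i f x := by
      intro i hi x
      rw [hform i hi, hform i hi]
      congr 1
      refine prod_congr rfl fun m hm => ?_
      have hmM := mem_of_mem_erase hm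
      have hmv : m ∉ ({v} : Finset ι) := by
        rw [mem_singleton]
        rintro rfl
        exact hvM hmM
      rw [hLv m hmM, mul_flipSet_apply_of_notMem hmv]
    have hunit : ∀ m ∈ M, ∀ x, ∃ a : ℤˣ, c * L m x = ((a : ℤ) : ℝ) := by
      intro m hm x
      rw [hLU m hm]
      have : c * (s m * chi (U m) x) = 1 ∨ c * (s m * chi (U m) x) = -1 := by
        rcases hc1 with h | h <;> rcases hs m hm with h1 | h1 <;>
          rcases chi_eq_one_or (U m) x with h2 | h2 <;> rw [h, h1, h2] <;> norm_num
      rcases this with h | h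
      · exact ⟨1, by simp [h]⟩
      · exact ⟨-1, by simp [h]⟩
    choose! a ha using hunit
    have hconst : ∀ x, f x - f (x * flipSet {v}) = 0 := by
      intro x
      set S := M.filter fun m => x m ≠ a m x with hS
      have hSM : S ⊆ M := filter_subset _ _
      rw [← sub_flipSet_of_deriv_eq hvM hDv hSM x]
      set z := x * flipSet S with hz
      have hza : ∀ m ∈ M, c * L m z = ((z m : ℤ) : ℝ) := by
        intro m hm
        have h1 : L m z = L m x := by
          simp only [hL, hz, flipSum_flipSet hSM]
        rw [h1, ha m hm]
        by_cases hxm : x m = a m x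
        · have : m ∉ S := by simp [hS, hxm]
          rw [hz, mul_flipSet_apply_of_notMem this, hxm]
        · have : m ∈ S := by simp [hS, hxm, hm]
          rw [hz, mul_flipSet_apply_of_mem this]
          have := units_eq_neg_of_ne hxm
          push_cast
          linarith
      obtain ⟨i, hi⟩ : M.Nonempty := card_pos.1 (by omega)
      have hne : BoolCube.deriv i f z ≠ 0 := by
        rw [hform i hi]
        refine mul_ne_zero (by rcases hc1 with h | h <;> rw [h] <;> norm_num) ?_
        refine prod_ne_zero_iff.2 fun m hm => ?_
        rw [hza m (mem_of_mem_erase hm)]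
        rcases Int.units_eq_one_or (z m) with h | h <;> rw [h] <;> norm_num
      have hiv : i ∉ ({v} : Finset ι) := by
        rw [mem_singleton]
        rintro rfl
        exact hvM hi
      rw [hf.eq_mul_deriv hne, hf.eq_mul_deriv (x := z * flipSet {v}) (i := i)
        (by rwa [hDv i hi]), hDv i hi, mul_flipSet_apply_of_notMem hiv, sub_self]
    funext x
    simp [BoolCube.deriv, hconst x]
  have hsum : totalWeight f = ∑ v ∈ V, weight (BoolCube.deriv v f) := by
    refine (sum_subset (subset_univ V) fun v _ hv => ?_).symm
    rw [hVz v hv, weight_zero]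
  have h2 : (#M : ℝ) ≤ 2 ^ (#M - 1) := by
    have : #M - 1 < 2 ^ (#M - 1) := Nat.lt_two_pow_self
    have : #M ≤ 2 ^ (#M - 1) := by omega
    exact_mod_cast this
  rw [hsum]
  calc ∑ v ∈ V, weight (BoolCube.deriv v f) ≤ ∑ v ∈ V, (1 / 2) ^ #M := sum_le_sum hVw
    _ = #V * (1 / 2) ^ #M := by rw [sum_const, nsmul_eq_mul]
    _ ≤ (2 * #M : ℕ) * (1 / 2) ^ #M := by gcongr
    _ = #M * (1 / 2) ^ (#M - 1) := by rw [hpow]; push_cast; ring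
    _ ≤ 2 ^ (#M - 1) * (1 / 2) ^ (#M - 1) := by gcongr
    _ = 1 := by rw [← mul_pow]; norm_num

omit [Fintype ι] [DecidableEq ι] in
lemma IsBool.ne_zero {f : (ι → ℤˣ) → ℝ} (hf : IsBool f) : f ≠ 0 := by
  rintro rfl
  rcases hf 1 with h | h <;> simp at h

lemma weight_deriv_le {f : (ι → ℤˣ) → ℝ} {M : Finset ι} (hM : coef f M ≠ 0) {i : ι}
    (hi : i ∈ M) : weight (deriv i f) ≤ (1 / 2) ^ #M := by
  have := weight_le_of_coef (f := deriv i f) (S := M.erase i) (by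
    rwa [coef_deriv, if_neg (notMem_erase _ _), insert_erase hi])
  rwa [card_erase_add_one hi] at this

lemma deriv_ne_zero {f : (ι → ℤˣ) → ℝ} {M : Finset ι} (hM : coef f M ≠ 0) {i : ι}
    (hi : i ∈ M) : deriv i f ≠ 0 := by
  intro h
  have := coef_deriv i f (M.erase i)
  rw [h, coef_zero, if_neg (notMem_erase _ _), insert_erase hi] at this
  exact hM this.symm

/-- The coordinates on which `f` depends. -/
noncomputable def relevant (f : (ι → ℤˣ) → ℝ) : Finset ι := by
  classical exact univ.filter fun i => deriv i f ≠ 0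

lemma mem_relevant {f : (ι → ℤˣ) → ℝ} {i : ι} : i ∈ relevant f ↔ deriv i f ≠ 0 := by
  simp [relevant]

lemma card_relevant_restr_lt {f : (ι → ℤˣ) → ℝ} {i : ι} (h : i ∈ relevant f) (s : ℤˣ) :
    #(relevant (restr i s f)) < #(relevant f) := by
  refine card_lt_card ((ssubset_iff_of_subset fun j hj => ?_).2 ⟨i, h, ?_⟩)
  · rw [mem_relevant] at hj ⊢
    intro hc
    by_cases hji : j = i
    · subst hji
      exact hj (deriv_restr_self _ _ _)
    · rw [deriv_restr_of_ne hji, hc] at hj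
      exact hj rfl
  · rw [mem_relevant, not_not]
    exact deriv_restr_self _ _ _

lemma IsBool.totalWeight_le_totalInfl {f : (ι → ℤˣ) → ℝ} (hf : IsBool f) :
    totalWeight f ≤ (totalInfl f + 1) / 3 := by
  induction hn : #(relevant f) using Nat.strong_induction_on generalizing f with
  | _ n ih =>
    have hW := hf.totalWeight_le
    by_cases hd : deg f ≤ 2
    · have := hf.totalInfl_le ((degLE_deg f).mono hd)
      push_cast at this
      linarith
    obtain ⟨M, hM1, hM2⟩ := exists_card_eq_deg hf.ne_zero
    by_cases hI : ∀ i ∈ M, infl i f < 3 * (1 / 2) ^ #M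
    · have := hf.totalWeight_le_one (hM1 ▸ degLE_deg f) (by omega) hM2 hI
      rcases le_total (totalInfl f) 2 with h | h <;> linarith
    push Not at hI
    obtain ⟨i, hi, hI⟩ := hI
    have hrel : i ∈ relevant f := mem_relevant.2 (deriv_ne_zero hM2 hi)
    have h1 := ih _ (hn ▸ card_relevant_restr_lt hrel 1) (hf.restr i 1) rfl
    have h2 := ih _ (hn ▸ card_relevant_restr_lt hrel (-1)) (hf.restr i (-1)) rfl
    have h3 := totalWeight_le_restr i f
    have h4 := totalInfl_restr i f
    have h5 := weight_deriv_le hM2 hi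
    linarith

end

section

variable {ι : Type*} [DecidableEq ι]

/-- `f` has `l` pairwise disjoint sensitive blocks at some point. -/
def HasBlocks (f : (ι → ℤˣ) → ℝ) (l : ℕ) : Prop :=
  ∃ (x : ι → ℤˣ) (B : Fin l → Finset ι), (∀ i j, i ≠ j → Disjoint (B i) (B j)) ∧
    ∀ j, f (x * flipSet (B j)) ≠ f x

omit [DecidableEq ι] in
lemma chi_prod {κ : Type*} (J : Finset κ) (y : κ → ι → ℤˣ) (S : Finset ι) :
    chi S (∏ j ∈ J, y j) = ∏ j ∈ J, chi S (y j) := by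
  classical
  induction J using Finset.induction_on with
  | empty => simp [chi]
  | insert j J hj ih => rw [prod_insert hj, prod_insert hj, chi_mul, ih]

/-- The number of blocks `B j` that meet `S` in an odd number of points. -/
noncomputable def oddBlocks {κ : Type*} [Fintype κ] (B : κ → Finset ι) (S : Finset ι) : ℕ := by
  classical exact #(univ.filter fun j => chi S (flipSet (B j)) = -1)

section

variable {κ : Type*} [Fintype κ] {B : κ → Finset ι} {S : Finset ι}

lemma oddBlocks_le (hB : ∀ i j, i ≠ j → Disjoint (B i) (B j)) : oddBlocks B S ≤ #S := by
  classical
  have h : ∀ j ∈ univ.filter fun j => chi S (flipSet (B j)) = -1, ∃ i, i ∈ S ∧ i ∈ B j := by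
    intro j hj
    rw [mem_filter] at hj
    by_contra! hc
    have := chi_flipSet_of_disjoint (Finset.disjoint_left.2 hc)
    rw [hj.2] at this
    norm_num at this
  choose p hp using h
  unfold oddBlocks
  refine card_le_card_of_injective (f := fun j => ⟨p j.1 j.2, (hp j.1 j.2).1⟩) ?_
  intro i j hij
  by_contra hne
  rw [Subtype.mk.injEq] at hij
  exact Finset.disjoint_left.1 (hB i j (Subtype.coe_injective.ne hne)) (hp i i.2).2
    (hij ▸ (hp j j.2).2)

lemma oddBlocks_eq : (oddBlocks B S : ℝ) = ∑ j, (1 - chi S (flipSet (B j))) / 2 := by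
  classical
  unfold oddBlocks
  rw [card_filter]
  push_cast
  refine sum_congr rfl fun j _ => ?_
  rcases chi_eq_one_or S (flipSet (B j)) with h | h <;> rw [h] <;> norm_num

lemma pow_oddBlocks (u : ℝ) : u ^ oddBlocks B S =
    ∏ j, ((1 - u) / 2 * chi S (flipSet (B j)) + (1 + u) / 2) := by
  classical
  unfold oddBlocks
  rw [← prod_const, prod_filter]
  refine prod_congr rfl fun j _ => ?_
  rcases chi_eq_one_or S (flipSet (B j)) with h | h <;> rw [h] <;> norm_num <;> ring

end

variable [Fintype ι]

lemma fourier_mul (f : (ι → ℤˣ) → ℝ) (x y : ι → ℤˣ) :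
    f (x * y) = ∑ S, coef f S * chi S x * chi S y := by
  rw [fourier f]
  simp only [chi_mul, mul_assoc]

open Polynomial in
lemma IsBool.blocks_bound {f : (ι → ℤˣ) → ℝ} (hf : IsBool f) {d : ℕ} (hd : DegLE f d)
    {κ : Type*} [Fintype κ] [DecidableEq κ] (x : ι → ℤˣ) (B : κ → Finset ι)
    (hB : ∀ i j, i ≠ j → Disjoint (B i) (B j)) (hs : ∀ j, f (x * flipSet (B j)) ≠ f x) :
    (Fintype.card κ : ℝ) * (Fintype.card κ - 1) ≤ 2 / 3 * ((d : ℝ) ^ 2 * (d ^ 2 - 1)) := by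
  set b : Finset ι → ℝ := fun S => f x * (coef f S * chi S x) with hb
  have hbf : ∀ y, ∑ S, b S * chi S y = f x * f (x * y) := by
    intro y
    rw [fourier_mul f x y, mul_sum]
    exact sum_congr rfl fun S _ => by simp only [hb]; ring
  have hff : f x * f x = 1 := by rcases hf x with h | h <;> rw [h] <;> norm_num
  set P : ℝ[X] := ∑ S, C (b S) * X ^ oddBlocks B S with hP
  have hPdeg : P.degree ≤ d := by
    refine (degree_sum_le _ _).trans (Finset.sup_le fun S _ => ?_)
    by_cases hS : d < #S
    · simp [hb, hd S hS]
    · refine (degree_C_mul_X_pow_le _ _).trans ?_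
      have := oddBlocks_le (S := S) hB
      exact_mod_cast this.trans (not_lt.1 hS)
  have hPeval : ∀ u, P.eval u = ∑ S, b S * u ^ oddBlocks B S := by
    intro u
    simp [hP, eval_finsetSum]
  have hPbnd : ∀ u ∈ Set.Icc (-1 : ℝ) 1, |P.eval u| ≤ 1 := by
    intro u hu
    set w : Finset κ → ℝ := fun J => (∏ j ∈ J, (1 - u) / 2) * ∏ j ∈ Jᶜ, (1 + u) / 2 with hw
    have hw0 : ∀ J, 0 ≤ w J := fun J => mul_nonneg
      (prod_nonneg fun _ _ => by linarith [hu.2]) (prod_nonneg fun _ _ => by linarith [hu.1])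
    have hw1 : ∑ J, w J = 1 := by
      simp only [hw]
      rw [← Fintype.prod_add]
      exact prod_eq_one fun _ _ => by ring
    have h1 : P.eval u = ∑ J, w J * (f x * f (x * ∏ j ∈ J, flipSet (B j))) := by
      rw [hPeval]
      have : ∀ S, b S * u ^ oddBlocks B S =
          ∑ J, w J * (b S * chi S (∏ j ∈ J, flipSet (B j))) := by
        intro S
        rw [pow_oddBlocks, Fintype.prod_add, mul_sum]
        refine sum_congr rfl fun J _ => ?_
        rw [prod_mul_distrib, chi_prod]
        simp only [hw]
        ring
      simp only [this]
      rw [sum_comm]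
      refine sum_congr rfl fun J _ => ?_
      rw [← mul_sum, hbf]
    rw [h1, ← hw1]
    refine (abs_sum_le_sum_abs _ _).trans (sum_le_sum fun J _ => ?_)
    rw [abs_mul, abs_of_nonneg (hw0 J)]
    refine mul_le_of_le_one_right (hw0 J) (le_of_eq ?_)
    rcases hf x with h | h <;> rcases hf (x * ∏ j ∈ J, flipSet (B j)) with h' | h' <;>
      rw [h, h'] <;> norm_num
  have key := Polynomial.Chebyshev.eval_iterate_derivative_le_of_forall_abs_le_one (k := 2)
    (le_refl (1 : ℝ)) hPdeg hPbnd
  rw [Polynomial.Chebyshev.iterate_derivative_T_eval_one_eq_div] at key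
  have hT : ((∏ l ∈ range 2, (((d : ℕ) : ℤ) ^ 2 - (l : ℤ) ^ 2) : ℤ) : ℝ) =
      (d : ℝ) ^ 2 * (d ^ 2 - 1) := by
    simp [prod_range_succ]
  have hD : (derivative^[2] P).eval 1 =
      ∑ S, b S * ((oddBlocks B S : ℝ) * (oddBlocks B S - 1)) := by
    rw [hP, iterate_derivative_sum, eval_finsetSum]
    refine sum_congr rfl fun S _ => ?_
    rw [iterate_derivative_C_mul, iterate_derivative_X_pow_eq_natCast_mul]
    rw [eval_C_mul, eval_mul, eval_natCast, Nat.cast_descFactorial_two, eval_pow, eval_X,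
      one_pow, mul_one]
  have hterm : ∀ S, 4 * ((oddBlocks B S : ℝ) * (oddBlocks B S - 1)) =
      ∑ i, ∑ j, if i = j then 0 else (1 - chi S (flipSet (B i)) - chi S (flipSet (B j)) +
        chi S (flipSet (B i) * flipSet (B j))) := by
    intro S
    have h1 : (oddBlocks B S : ℝ) = ∑ j, ((1 - chi S (flipSet (B j))) / 2) ^ 2 := by
      rw [oddBlocks_eq]
      refine sum_congr rfl fun j _ => ?_
      rcases chi_eq_one_or S (flipSet (B j)) with h | h <;> rw [h] <;> norm_num
    have h2 : (oddBlocks B S : ℝ) * (oddBlocks B S - 1) =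
        (∑ i, (1 - chi S (flipSet (B i))) / 2) * (∑ j, (1 - chi S (flipSet (B j))) / 2) -
          ∑ j, ((1 - chi S (flipSet (B j))) / 2) ^ 2 := by
      rw [← h1, ← oddBlocks_eq]
      ring
    rw [h2, sum_mul_sum, ← sum_sub_distrib, mul_sum]
    refine sum_congr rfl fun i _ => ?_
    have h3 : ((1 - chi S (flipSet (B i))) / 2) ^ 2 =
        ∑ j, if i = j then ((1 - chi S (flipSet (B i))) / 2) ^ 2 else 0 := by simp
    rw [h3, ← sum_sub_distrib, mul_sum]
    refine sum_congr rfl fun j _ => ?_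
    split_ifs with hij
    · subst hij
      ring
    · rw [chi_mul]
      ring
  have hsum : 4 * ∑ S, b S * ((oddBlocks B S : ℝ) * (oddBlocks B S - 1)) =
      ∑ i, ∑ j, if i = j then 0 else (f x * f (x * 1) - f x * f (x * flipSet (B i)) -
        f x * f (x * flipSet (B j)) + f x * f (x * (flipSet (B i) * flipSet (B j)))) := by
    have h1 : 4 * ∑ S, b S * ((oddBlocks B S : ℝ) * (oddBlocks B S - 1)) =
        ∑ S, b S * (4 * ((oddBlocks B S : ℝ) * (oddBlocks B S - 1))) := by
      rw [mul_sum]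
      exact sum_congr rfl fun S _ => by ring
    simp only [h1, hterm, mul_sum]
    rw [sum_comm]
    refine sum_congr rfl fun i _ => ?_
    rw [sum_comm]
    refine sum_congr rfl fun j _ => ?_
    split_ifs with hij
    · simp
    · simp only [← hbf]
      rw [← sum_sub_distrib, ← sum_sub_distrib, ← sum_add_distrib]
      refine sum_congr rfl fun S _ => ?_
      have : chi S (1 : ι → ℤˣ) = 1 := by simp [chi]
      rw [this]
      ring
  have hlow : ∀ i j, (if i = j then (0 : ℝ) else 2) ≤
      if i = j then 0 else (f x * f (x * 1) - f x * f (x * flipSet (B i)) -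
        f x * f (x * flipSet (B j)) + f x * f (x * (flipSet (B i) * flipSet (B j)))) := by
    intro i j
    split_ifs with hij
    · exact le_refl _
    · have hneg : ∀ j, f x * f (x * flipSet (B j)) = -1 := by
        intro j
        have := hs j
        rcases hf x with h | h <;> rcases hf (x * flipSet (B j)) with h' | h' <;>
          rw [h, h'] at this ⊢ <;> first | (exact absurd rfl this) | norm_num
      rw [hneg, hneg, mul_one, hff]
      have : -1 ≤ f x * f (x * (flipSet (B i) * flipSet (B j))) := by
        rcases hf x with h | h <;> rcases hf (x * (flipSet (B i) * flipSet (B j))) with h' | h' <;>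
          rw [h, h'] <;> norm_num
      linarith
  have hcount : ∑ i : κ, ∑ j : κ, (if i = j then (0 : ℝ) else 2) =
      2 * ((Fintype.card κ : ℝ) * (Fintype.card κ - 1)) := by
    have : ∀ i : κ, ∑ j : κ, (if i = j then (0 : ℝ) else 2) = 2 * (Fintype.card κ - 1) := by
      intro i
      have h1 : ∀ j, (if i = j then (0 : ℝ) else 2) = 2 - if i = j then 2 else 0 := by
        intro j
        split_ifs <;> norm_num
      simp only [h1, sum_sub_distrib, sum_ite_eq, mem_univ, if_true, sum_const, card_univ,
        nsmul_eq_mul]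
      ring
    simp only [this, sum_const, card_univ, nsmul_eq_mul]
    ring
  have hfin := sum_le_sum fun i (_ : i ∈ univ) => sum_le_sum fun j (_ : j ∈ univ) => hlow i j
  rw [hcount, ← hsum, ← hD] at hfin
  have h3 : ((∏ l ∈ range 2, (2 * l + 1) : ℕ) : ℝ) = 3 := by simp [prod_range_succ]
  rw [h3] at key
  rw [hT] at key
  linarith

lemma IsBool.hasBlocks_le {f : (ι → ℤˣ) → ℝ} (hf : IsBool f) {d l : ℕ} (hd : DegLE f d)
    (hd3 : 3 ≤ d) (h : HasBlocks f l) : (l : ℝ) ≤ 5 / 6 * (d : ℝ) ^ 2 := by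
  obtain ⟨x, B, hB, hs⟩ := h
  have h1 := hf.blocks_bound hd x B hB hs
  rw [Fintype.card_fin] at h1
  have h2 : (3 : ℝ) ≤ d := by exact_mod_cast hd3
  have h3 : (9 : ℝ) ≤ (d : ℝ) ^ 2 := by nlinarith
  by_contra! hc
  nlinarith

lemma exists_sensitive_subset {f : (ι → ℤˣ) → ℝ} {M : Finset ι} (hd : DegLE f #M)
    (hM : M.Nonempty) (hcoef : coef f M ≠ 0) (x : ι → ℤˣ) :
    ∃ S ⊆ M, f (x * flipSet S) ≠ f x := by
  by_contra! hc
  have h1 := flipSum_self hd x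
  have h2 : flipSum M M f x = f x * chi M x * ∑ S ∈ M.powerset, chi M (flipSet S) := by
    rw [mul_sum]
    refine sum_congr rfl fun S hS => ?_
    rw [hc S (mem_powerset.1 hS), chi_mul, mul_assoc]
  rw [sum_chi_flipSet, if_neg (by rw [disjoint_self_iff_empty]; exact hM.ne_empty),
    mul_zero, h1] at h2
  exact (mul_ne_zero (by positivity) hcoef) h2

lemma HasBlocks.of_restrSet {f : (ι → ℤˣ) → ℝ} {M : Finset ι} (hd : DegLE f #M)
    (hM : M.Nonempty) (hcoef : coef f M ≠ 0) {y : ι → ℤˣ} {l : ℕ}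
    (h : HasBlocks (restrSet M y f) l) : HasBlocks f (l + 1) := by
  obtain ⟨x, B, hB, hs⟩ := h
  obtain ⟨S, hS, hfS⟩ := exists_sensitive_subset hd hM hcoef (M.piecewise y x)
  have hdis : ∀ j, Disjoint S (B j \ M) := fun j => disjoint_sdiff.mono_left hS
  refine ⟨M.piecewise y x, Fin.cons S fun j => B j \ M, ?_, ?_⟩
  · intro i j
    refine Fin.cases ?_ (fun i => ?_) i <;> refine Fin.cases ?_ (fun j => ?_) j
    · simp
    · intro _
      simpa using hdis j
    · intro _
      simpa using (hdis i).symm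
    · intro hij
      simpa using (hB i j (by simpa using hij)).mono sdiff_subset sdiff_subset
  · intro j
    refine Fin.cases ?_ (fun j => ?_) j
    · simpa using hfS
    · have : M.piecewise y x * flipSet (B j \ M) = M.piecewise y (x * flipSet (B j)) := by
        funext i
        by_cases hi : i ∈ M <;> simp [flipSet, hi]
      rw [Fin.cons_succ, this]
      exact hs j

/-- A bound for the total weight of functions of degree `≤ j` extends to degree `j + 1` at a cost
proportional to the block sensitivity. -/
lemma totalWeight_le_of_degLE_succ {j : ℕ} {C : ℝ}
    (h : ∀ (b : ℕ) (f : (ι → ℤˣ) → ℝ), IsBool f → DegLE f j → (∀ l, HasBlocks f l → l ≤ b) →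
      totalWeight f ≤ C + (j + 1) * (1 / 2) ^ (j + 1) * b)
    (b : ℕ) (f : (ι → ℤˣ) → ℝ) (hf : IsBool f) (hd : DegLE f (j + 1))
    (hb : ∀ l, HasBlocks f l → l ≤ b) :
    totalWeight f ≤ C + (j + 1) * (1 / 2) ^ (j + 1) * b := by
  induction b generalizing f with
  | zero =>
    refine h 0 f hf ?_ hb
    intro S hS
    by_contra hc
    have hcard : #S = j + 1 := by
      by_contra hne
      exact hc (hd S (by omega))
    have hne : S.Nonempty := card_pos.1 (by omega)
    have := hb _ (HasBlocks.of_restrSet (hcard ▸ hd) hne hc (y := 1) (l := 0)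
      ⟨1, fun _ => ∅, fun i => i.elim0, fun i => i.elim0⟩)
    omega
  | succ b ih =>
    by_cases hd' : DegLE f j
    · exact h _ f hf hd' hb
    unfold DegLE at hd'
    push Not at hd'
    obtain ⟨M, hM, hc⟩ := hd'
    have hcard : #M = j + 1 := by
      by_contra hne
      exact hc (hd M (by omega))
    have h1 : ∑ i ∈ M, weight (deriv i f) ≤ (j + 1) * (1 / 2) ^ (j + 1) := by
      refine (sum_le_sum fun i hi => weight_deriv_le hc hi).trans (le_of_eq ?_)
      rw [sum_const, nsmul_eq_mul, hcard]
      push_cast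
      ring
    have h2 : ∀ y, totalWeight (restrSet M y f) ≤ C + (j + 1) * (1 / 2) ^ (j + 1) * b := by
      refine fun y => ih _ (hf.restrSet M y) (hd.restrSet M y) fun l hl => ?_
      have := hb _ (hl.of_restrSet (hcard ▸ hd) (card_pos.1 (by omega)) hc)
      omega
    have h3 := totalWeight_le_restrSet M f
    have h4 := expect_le_expect fun y (_ : y ∈ (univ : Finset (ι → ℤˣ))) => h2 y
    rw [expect_const univ_nonempty] at h4
    push_cast
    linarith

lemma IsBool.totalWeight_le_of_blocks (i b : ℕ) (f : (ι → ℤˣ) → ℝ) (hf : IsBool f)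
    (hd : DegLE f (i + 11)) (hb : ∀ l, HasBlocks f l → l ≤ b) :
    totalWeight f ≤ 11 / 3 + 5 / 6 * (1660 / 2048) -
      5 / 6 * (((i + 11 : ℕ) : ℝ) ^ 3 + 2 * ((i + 11 : ℕ) : ℝ) ^ 2 + 7 * ((i + 11 : ℕ) : ℝ) + 10) *
        (1 / 2) ^ (i + 11) + ((i + 11 : ℕ) : ℝ) * (1 / 2) ^ (i + 11) * b := by
  induction i generalizing f b with
  | zero =>
    have h := totalWeight_le_of_degLE_succ (ι := ι) (j := 10) (C := 11 / 3) (fun b f hf hd _ => ?_)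
      b f hf hd hb
    · norm_num at h ⊢
      linarith
    · have h1 := hf.totalInfl_le hd
      have h2 := hf.totalWeight_le_totalInfl
      have : (0 : ℝ) ≤ ((10 : ℕ) + 1) * (1 / 2) ^ (10 + 1) * b := by positivity
      push_cast at *
      linarith
  | succ i ih =>
    set j := i + 11 with hj
    have hs : i + 1 + 11 = j + 1 := by omega
    rw [hs] at hd ⊢
    have key := totalWeight_le_of_degLE_succ (ι := ι) (j := j)
      (C := 11 / 3 + 5 / 6 * (1660 / 2048) -
      5 / 6 * (((j + 1 : ℕ) : ℝ) ^ 3 + 2 * ((j + 1 : ℕ) : ℝ) ^ 2 + 7 * ((j + 1 : ℕ) : ℝ) + 10) *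
        (1 / 2) ^ (j + 1)) (fun b f hf hd hb => ?_) b f hf hd hb
    · push_cast at key ⊢
      exact key
    · have h1 : ∀ l, HasBlocks f l → l ≤ min b ⌊5 / 6 * (j : ℝ) ^ 2⌋₊ := fun l hl =>
        le_min (hb l hl) (Nat.le_floor (hf.hasBlocks_le hd (by omega) hl))
      have h2 := ih _ f hf hd h1
      set β := min b ⌊5 / 6 * (j : ℝ) ^ 2⌋₊
      have h3 : (β : ℝ) ≤ b := by exact_mod_cast min_le_left _ _
      have h4 : (β : ℝ) ≤ 5 / 6 * (j : ℝ) ^ 2 :=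
        (Nat.cast_le.2 (min_le_right _ _)).trans (Nat.floor_le (by positivity))
      have hj1 : (1 : ℝ) ≤ j := by exact_mod_cast (by omega : 1 ≤ j)
      have hp : (0 : ℝ) < (1 / 2) ^ (j + 1) := by positivity
      rw [show ((1 : ℝ) / 2) ^ j = 2 * (1 / 2) ^ (j + 1) by ring] at h2
      set p : ℝ := (1 / 2) ^ (j + 1)
      have h5 : ((j : ℝ) + 1) * p * β ≤ (j + 1) * p * b := by gcongr
      have h6 : ((j : ℝ) - 1) * p * β ≤ (j - 1) * p * (5 / 6 * (j : ℝ) ^ 2) :=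
        mul_le_mul_of_nonneg_left h4 (mul_nonneg (by linarith) hp.le)
      push_cast
      linear_combination h2 + h5 + h6

lemma IsBool.totalWeight_le_const {f : (ι → ℤˣ) → ℝ} (hf : IsBool f) :
    totalWeight f ≤ 4.394 := by
  set i := deg f
  have hd : DegLE f (i + 11) := (degLE_deg f).mono (by omega)
  have h1 := hf.totalWeight_le_of_blocks i ⌊5 / 6 * ((i + 11 : ℕ) : ℝ) ^ 2⌋₊ f hd fun l hl =>
    Nat.le_floor (hf.hasBlocks_le hd (by omega) hl)
  have h2 := Nat.floor_le (show (0 : ℝ) ≤ 5 / 6 * ((i + 11 : ℕ) : ℝ) ^ 2 by positivity)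
  have ht : (0 : ℝ) ≤ ((i + 11 : ℕ) : ℝ) := Nat.cast_nonneg _
  have hp : (0 : ℝ) < (1 / 2) ^ (i + 11) := by positivity
  generalize ((i + 11 : ℕ) : ℝ) = t at h1 h2 ht
  generalize ((1 : ℝ) / 2) ^ (i + 11) = p at h1 hp
  have h3 := mul_le_mul_of_nonneg_left h2 (mul_nonneg ht hp.le)
  have h4 : 0 ≤ p * (2 * t ^ 2 + 7 * t + 10) := by positivity
  norm_num
  linarith

end

lemma card_relevant_le {ι : Type*} [Fintype ι] [DecidableEq ι] {f : (ι → ℤˣ) → ℝ} {k : ℕ}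
    (hd : DegLE f k) : (#(relevant f) : ℝ) ≤ totalWeight f * 2 ^ k := by
  have h : ∀ i ∈ relevant f, (1 / 2 : ℝ) ^ k ≤ weight (deriv i f) := by
    intro i hi
    rw [mem_relevant] at hi
    cases k with
    | zero =>
      obtain ⟨S, hS⟩ := exists_coef_ne_zero hi
      rw [coef_deriv] at hS
      split_ifs at hS with hiS
      · exact absurd rfl hS
      · exact absurd (hd _ (card_pos.2 (insert_nonempty _ _))) hS
    | succ k => exact le_weight hi (hd.deriv i)
  have h1 : (#(relevant f) : ℝ) * (1 / 2) ^ k ≤ totalWeight f := by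
    rw [← nsmul_eq_mul]
    exact (card_nsmul_le_sum _ _ _ h).trans
      (sum_le_sum_of_subset_of_nonneg (subset_univ _) fun _ _ _ => weight_nonneg _)
  calc (#(relevant f) : ℝ) = #(relevant f) * (1 / 2) ^ k * 2 ^ k := by
        rw [mul_assoc, ← mul_pow]
        norm_num
    _ ≤ _ := by gcongr

lemma eq_of_eqOn_relevant {ι : Type*} [Fintype ι] [DecidableEq ι] {f : (ι → ℤˣ) → ℝ}
    {x y : ι → ℤˣ} (h : ∀ i ∈ relevant f, x i = y i) : f x = f y := by
  rw [fourier f x, fourier f y]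
  refine sum_congr rfl fun S _ => ?_
  by_cases hS : coef f S = 0
  · rw [hS, zero_mul, zero_mul]
  · congr 1
    exact prod_congr rfl fun i hi => by rw [h i (mem_relevant.2 (deriv_ne_zero hS hi))]

section

variable {n : ℕ}

lemma flipCoord_eq_mul (x : Fin n → ℤˣ) (i : Fin n) : flipCoord x i = x * flipSet {i} := by
  funext j
  by_cases h : j = i
  · subst h
    simp [flipCoord, flipSet]
  · simp [flipCoord, flipSet, h]

lemma isBool_toReal (f : (Fin n → ℤˣ) → ℤˣ) : IsBool (toReal f) := by
  intro x
  unfold toReal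
  rcases Int.units_eq_one_or (f x) with h | h <;> simp [h]

lemma toReal_eq_iff {f : (Fin n → ℤˣ) → ℤˣ} {x y : Fin n → ℤˣ} :
    toReal f x = toReal f y ↔ f x = f y := by
  rw [toReal, toReal, Int.cast_inj, Units.val_inj]

lemma degLE_of_isKFun {k : ℕ} {f : (Fin n → ℤˣ) → ℤˣ} (hf : IsKFun k f) : DegLE (toReal f) k := by
  classical
  set g := toReal f with hg
  have h : ∀ x, ∑ i, 1 / 2 * (g x - g (x * flipSet {i})) = k * g x := by
    intro x
    have h1 : ∀ i, 1 / 2 * (g x - g (x * flipSet {i})) =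
        if f (flipCoord x i) ≠ f x then g x else 0 := by
      intro i
      rw [← flipCoord_eq_mul]
      split_ifs with hi
      · rw [← toReal_eq_iff.ne, ← hg] at hi
        rcases isBool_toReal f x with h | h <;>
          rcases isBool_toReal f (flipCoord x i) with h' | h' <;> rw [← hg] at h h' <;>
          rw [h, h'] at hi ⊢ <;> first | exact absurd rfl hi | norm_num
      · rw [not_not, ← toReal_eq_iff, ← hg] at hi
        rw [hi]
        ring
    simp only [h1]
    rw [← sum_filter, sum_const, nsmul_eq_mul]
    congr 2
    rw [← hf x, ← Set.ncard_coe_finset]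
    congr 1
    ext i
    simp
  intro S hS
  have h2 : ∑ i, coef (fun x => 1 / 2 * (g x - g (x * flipSet {i}))) S = k * coef g S := by
    rw [← coef_const_mul]
    simp only [← h, coef, sum_mul]
    rw [expect_sum_comm]
  have h3 : ∀ i, coef (fun x => 1 / 2 * (g x - g (x * flipSet {i}))) S =
      if i ∈ S then coef g S else 0 := by
    intro i
    rw [coef_const_mul, coef_sub, coef_translate, chi_flipSet_singleton]
    split_ifs <;> ring
  simp only [h3] at h2
  rw [← sum_filter, filter_mem_eq_inter, univ_inter, sum_const, nsmul_eq_mul] at h2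
  by_contra hc
  have := mul_right_cancel₀ hc h2
  exact absurd (Nat.cast_injective this) hS.ne'

/-- A `k`-function depends on at most `4.394 * 2 ^ k` coordinates. -/
lemma exists_dependsOn_of_isKFun {k : ℕ} {f : (Fin n → ℤˣ) → ℤˣ} (hf : IsKFun k f) :
    ∃ R : Finset (Fin n), (#R : ℝ) ≤ 4.394 * 2 ^ k ∧ DependsOn f R ∧
      ∀ i ∈ R, ∃ x, f (flipCoord x i) ≠ f x := by
  refine ⟨relevant (toReal f), ?_, ?_, ?_⟩
  · refine (card_relevant_le (degLE_of_isKFun hf)).trans ?_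
    gcongr
    exact (isBool_toReal f).totalWeight_le_const
  · intro x y hxy
    exact toReal_eq_iff.1 (eq_of_eqOn_relevant hxy)
  · intro i hi
    by_contra! hc
    refine mem_relevant.1 hi ?_
    funext x
    unfold deriv
    rw [← flipCoord_eq_mul, toReal_eq_iff.2 (hc x)]
    simp

end

section

variable {m n k : ℕ}

lemma isom_toReal_iff {f g : (Fin n → ℤˣ) → ℤˣ} : Isom (toReal f) (toReal g) ↔
    ∃ (ε : ℤˣ) (α : Fin n → ℤˣ) (σ : Equiv.Perm (Fin n)),
      ∀ x, f x = ε * g (fun i => α i * x (σ i)) := by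
  unfold Isom toReal
  refine exists_congr fun ε => exists_congr fun α => exists_congr fun σ => forall_congr' fun x => ?_
  rw [← Int.cast_mul, ← Units.val_mul, Int.cast_inj, Units.val_inj]

lemma equivalence_isom : Equivalence fun f g : (Fin n → ℤˣ) → ℤˣ => Isom (toReal f) (toReal g) where
  refl f := isom_toReal_iff.2 ⟨1, 1, 1, fun x => by simp⟩
  symm {f g} h := by
    rw [isom_toReal_iff] at h ⊢
    obtain ⟨ε, α, σ, h⟩ := h
    refine ⟨ε, fun i => α (σ.symm i), σ.symm, fun y => ?_⟩
    rw [h, ← mul_assoc, Int.units_mul_self, one_mul]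
    congr 1
    funext i
    simp only [σ.symm_apply_apply]
    rw [← mul_assoc, Int.units_mul_self, one_mul]
  trans {f g l} h h' := by
    rw [isom_toReal_iff] at h h' ⊢
    obtain ⟨ε, α, σ, h⟩ := h
    obtain ⟨ε', α', σ', h'⟩ := h'
    refine ⟨ε * ε', fun i => α' i * α (σ' i), σ'.trans σ, fun x => ?_⟩
    rw [h, h', mul_assoc]
    simp only [mul_assoc, Equiv.trans_apply]

/-- View a function on `Q_m` as a function on `Q_n` of the first `m` coordinates. -/
def extendFun (h : m ≤ n) (f : (Fin m → ℤˣ) → ℤˣ) : (Fin n → ℤˣ) → ℤˣ :=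
  fun x => f fun i => x (Fin.castLE h i)

/-- Extend a vertex of `Q_m` to a vertex of `Q_n` by ones. -/
noncomputable def extendVec (h : m ≤ n) (x : Fin m → ℤˣ) : Fin n → ℤˣ :=
  Function.extend (Fin.castLE h) x 1

lemma extendVec_castLE (h : m ≤ n) (x : Fin m → ℤˣ) (i : Fin m) :
    extendVec h x (Fin.castLE h i) = x i :=
  (Fin.castLE_injective h).extend_apply _ _ _

lemma extendFun_extendVec (h : m ≤ n) (f : (Fin m → ℤˣ) → ℤˣ) (x : Fin m → ℤˣ) :
    extendFun h f (extendVec h x) = f x := by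
  simp only [extendFun, extendVec_castLE]

lemma extendFun_flipCoord_castLE (h : m ≤ n) (f : (Fin m → ℤˣ) → ℤˣ) (x : Fin n → ℤˣ)
    (i : Fin m) : extendFun h f (flipCoord x (Fin.castLE h i)) =
      f (flipCoord (fun i => x (Fin.castLE h i)) i) := by
  unfold extendFun flipCoord
  congr 1
  funext j
  by_cases hj : j = i
  · subst hj
    simp
  · rw [Function.update_of_ne hj, Function.update_of_ne ((Fin.castLE_injective h).ne hj)]

lemma extendFun_flipCoord_of_notMem (h : m ≤ n) (f : (Fin m → ℤˣ) → ℤˣ) (x : Fin n → ℤˣ)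
    {i : Fin n} (hi : i ∉ Set.range (Fin.castLE h)) :
    extendFun h f (flipCoord x i) = extendFun h f x := by
  unfold extendFun flipCoord
  congr 1
  funext j
  rw [Function.update_of_ne]
  rintro rfl
  exact hi ⟨j, rfl⟩

lemma isKFun_extendFun (h : m ≤ n) {f : (Fin m → ℤˣ) → ℤˣ} :
    IsKFun k (extendFun h f) ↔ IsKFun k f := by
  have key : ∀ x, {i | extendFun h f (flipCoord x i) ≠ extendFun h f x} =
      Set.image (Fin.castLE h) {i | f (flipCoord (fun i => x (Fin.castLE h i)) i) ≠
        f fun i => x (Fin.castLE h i)} := by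
    intro x
    ext i
    constructor
    · intro hi
      by_cases hr : i ∈ Set.range (Fin.castLE h)
      · obtain ⟨j, rfl⟩ := hr
        rw [Set.mem_ofPred_eq, extendFun_flipCoord_castLE] at hi
        exact ⟨j, hi, rfl⟩
      · exact absurd (extendFun_flipCoord_of_notMem h f x hr) hi
    · rintro ⟨j, hj, rfl⟩
      rw [Set.mem_ofPred_eq, extendFun_flipCoord_castLE]
      exact hj
  constructor
  · intro hf x
    have := hf (extendVec h x)
    rw [key, Set.ncard_image_of_injective _ (Fin.castLE_injective h)] at this
    simpa only [extendVec_castLE] using this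
  · intro hf x
    rw [key, Set.ncard_image_of_injective _ (Fin.castLE_injective h)]
    exact hf _

lemma isKFun_comp_perm {f : (Fin n → ℤˣ) → ℤˣ} (hf : IsKFun k f) (σ : Equiv.Perm (Fin n)) :
    IsKFun k fun x => f fun i => x (σ i) := by
  intro x
  rw [← hf fun i => x (σ i), ← Set.ncard_image_of_injective
    {i | f (flipCoord (fun j => x (σ j)) i) ≠ f fun j => x (σ j)} σ.injective]
  congr 1
  have : ∀ i, (fun j => flipCoord x (σ i) (σ j)) = flipCoord (fun j => x (σ j)) i := by
    intro i
    funext j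
    by_cases hj : j = i
    · subst hj
      simp [flipCoord]
    · simp [flipCoord, hj]
  ext i
  constructor
  · intro hi
    refine ⟨σ.symm i, ?_, σ.apply_symm_apply i⟩
    rw [Set.mem_ofPred_eq, ← this, σ.apply_symm_apply]
    exact hi
  · rintro ⟨j, hj, rfl⟩
    change f (fun l => flipCoord x (σ j) (σ l)) ≠ _
    rw [this]
    exact hj

lemma isom_extendFun (h : m ≤ n) {f g : (Fin m → ℤˣ) → ℤˣ} (hfg : Isom (toReal f) (toReal g)) :
    Isom (toReal (extendFun h f)) (toReal (extendFun h g)) := by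
  rw [isom_toReal_iff] at hfg ⊢
  obtain ⟨ε, α, σ, hfg⟩ := hfg
  refine ⟨ε, extendVec h α, σ.viaEmbedding (Fin.castLEEmb h), fun x => ?_⟩
  have : ∀ i, σ.viaEmbedding (Fin.castLEEmb h) (Fin.castLE h i) = Fin.castLE h (σ i) :=
    σ.viaEmbedding_apply (Fin.castLEEmb h)
  unfold extendFun
  simp only [this, extendVec_castLE]
  exact hfg _

lemma isom_of_isom_extendFun (h : m ≤ n) {f g : (Fin m → ℤˣ) → ℤˣ} {R : Finset (Fin m)}
    (hR : DependsOn g R) (hs : ∀ i ∈ R, ∃ x, g (flipCoord x i) ≠ g x)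
    (hfg : Isom (toReal (extendFun h f)) (toReal (extendFun h g))) :
    Isom (toReal f) (toReal g) := by
  classical
  rw [isom_toReal_iff] at hfg ⊢
  obtain ⟨ε, α, σ, hfg⟩ := hfg
  have hr : ∀ i ∈ R, ∃ j, Fin.castLE h j = σ (Fin.castLE h i) := by
    intro i hi
    by_contra hc
    obtain ⟨z, hz⟩ := hs i hi
    set x : Fin n → ℤˣ := fun j => α (σ.symm j) * extendVec h z (σ.symm j) with hx
    have h1 : (fun j => α j * x (σ j)) = extendVec h z := by
      funext j
      rw [hx]
      simp only [σ.symm_apply_apply]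
      rw [← mul_assoc, Int.units_mul_self, one_mul]
    have h2 : (fun j => α j * flipCoord x (σ (Fin.castLE h i)) (σ j)) =
        flipCoord (extendVec h z) (Fin.castLE h i) := by
      rw [← h1]
      funext j
      by_cases hj : j = Fin.castLE h i
      · subst hj
        simp [flipCoord]
      · simp [flipCoord, hj]
    have h3 := extendFun_flipCoord_of_notMem h f x (i := σ (Fin.castLE h i)) hc
    rw [hfg, hfg x, h1, h2, extendFun_flipCoord_castLE, extendFun_extendVec] at h3
    simp only [extendVec_castLE] at h3
    exact hz (mul_left_cancel h3)
  have hr' : ∀ i, ∃ j, i ∈ R → Fin.castLE h j = σ (Fin.castLE h i) := by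
    intro i
    by_cases hi : i ∈ R
    · obtain ⟨j, hj⟩ := hr i hi
      exact ⟨j, fun _ => hj⟩
    · exact ⟨i, fun hi' => absurd hi' hi⟩
  choose t ht using hr'
  obtain ⟨τ, hτ⟩ := Finset.exists_equiv_extend_of_card_eq (t := univ) (by simp)
    (subset_univ (R.image t)) (s := R) (f := t) (by
      intro i hi j hj hij
      have := ht i hi
      rw [hij, ht j hj] at this
      exact (Fin.castLE_injective h (σ.injective this)).symm)
  refine ⟨ε, fun i => α (Fin.castLE h i), τ.trans (Equiv.subtypeUnivEquiv fun i => mem_univ i),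
    fun y => ?_⟩
  rw [← extendFun_extendVec h f, hfg]
  congr 1
  refine hR fun i hi => ?_
  simp only [Equiv.trans_apply, Equiv.subtypeUnivEquiv_apply]
  rw [hτ i hi, ← ht i hi, extendVec_castLE]

lemma exists_isom_extendFun (h : m ≤ n) {f : (Fin n → ℤˣ) → ℤˣ} (hf : IsKFun k f)
    {R : Finset (Fin n)} (hR : DependsOn f R) (hcard : #R ≤ m) :
    ∃ g : (Fin m → ℤˣ) → ℤˣ, IsKFun k g ∧ Isom (toReal (extendFun h g)) (toReal f) := by
  classical
  obtain ⟨t, ht⟩ : ∃ t : Fin n → Fin n, (∀ i ∈ R, t i ∈ Set.range (Fin.castLE h)) ∧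
      Set.InjOn t R := by
    refine ⟨fun i => if hi : i ∈ R then Fin.castLE (hcard.trans h) (R.equivFin ⟨i, hi⟩) else i,
      ?_, ?_⟩
    · intro i hi
      simp only [dif_pos hi]
      exact ⟨Fin.castLE hcard (R.equivFin ⟨i, hi⟩), rfl⟩
    · intro i hi j hj hij
      rw [mem_coe] at hi hj
      simp only [dif_pos hi, dif_pos hj] at hij
      simpa using R.equivFin.injective (Fin.castLE_injective _ hij)
  obtain ⟨e, he⟩ := Finset.exists_equiv_extend_of_card_eq (t := univ) (by simp)
    (subset_univ (R.image t)) ht.2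
  set σ : Equiv.Perm (Fin n) := e.trans (Equiv.subtypeUnivEquiv fun i => mem_univ i)
  have hσ : ∀ i ∈ R, σ i ∈ Set.range (Fin.castLE h) := fun i hi => by
    have := ht.1 i hi
    rwa [← he i hi] at this
  have hext : (extendFun h fun y => f fun i => extendVec h y (σ i)) =
      fun x => f fun i => x (σ i) := by
    funext x
    refine hR fun i hi => ?_
    obtain ⟨j, hj⟩ := hσ i hi
    simp only [← hj, extendVec_castLE]
  refine ⟨fun y => f fun i => extendVec h y (σ i), ?_, ?_⟩
  · rw [← isKFun_extendFun h, hext]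
    exact isKFun_comp_perm hf σ
  · rw [hext, isom_toReal_iff]
    exact ⟨1, 1, σ, fun x => by simp⟩

end

end BoolCube

/-- `G(n,k)` is constant from `4.394 · 2^k` onwards. -/
theorem numIsoKFun_const_of_large (k m n : ℕ)
    (hm : (4.394 : ℝ) * 2 ^ k ≤ (m : ℝ)) (hmn : m ≤ n) :
    numIsoKFun n k = numIsoKFun m k := by
  symm
  refine Nat.card_eq_of_bijective (Quot.map (fun f => ⟨BoolCube.extendFun hmn f.1,
    (BoolCube.isKFun_extendFun hmn).2 f.2⟩) fun f g => BoolCube.isom_extendFun hmn) ⟨?_, ?_⟩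
  · rintro ⟨f⟩ ⟨g⟩ hfg
    obtain ⟨R, -, hR, hs⟩ := BoolCube.exists_dependsOn_of_isKFun g.2
    refine Quot.sound (BoolCube.isom_of_isom_extendFun hmn hR hs ?_)
    exact ((BoolCube.equivalence_isom.comap Subtype.val).quot_mk_eq_iff _ _).1 hfg
  · rintro ⟨f⟩
    obtain ⟨R, hcard, hR, -⟩ := BoolCube.exists_dependsOn_of_isKFun f.2
    obtain ⟨g, hg, hgf⟩ := BoolCube.exists_isom_extendFun hmn f.2 hR
      (by exact_mod_cast hcard.trans hm)
    exact ⟨Quot.mk _ ⟨g, hg⟩, Quot.sound hgf⟩
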